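/- For any set A ⊆ ℕ with positive upper Banach density and any positive integers ℓ, m, there exist an infinite set B ⊆ ℕ and a positive integer t such that {m·b₁ + ℓ·b₂ : b₁, b₂ ∈ B and b₁ < b₂} + t ⊆ A. -/

import Mathlib

open Filter MeasureTheory Topology

open scoped Classical in
/-- Upper Banach density: `limsup` over window length `N` of the maximal count of
elements of `A` in a window of length `N`, divided by `N`. -/
noncomputable def upperBanachDensity (A : Set ℕ) : ℝ :=
  Filter.limsup
    (fun N : ℕ => ⨆ M : ℕ, (((Finset.Ico M (M + N)).filter (· ∈ A)).card : ℝ) / N)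
    Filter.atTop

open scoped Classical in
/-- Natural upper density of a set of naturals. -/
noncomputable def upperDensity (A : Set ℕ) : ℝ :=
  Filter.limsup (fun N : ℕ => (((Finset.Icc 1 N).filter (· ∈ A)).card : ℝ) / N)
    Filter.atTop

open scoped Classical in
/-- Natural lower density of a set of naturals. -/
noncomputable def lowerDensity (A : Set ℕ) : ℝ :=
  Filter.liminf (fun N : ℕ => (((Finset.Icc 1 N).filter (· ∈ A)).card : ℝ) / N)
    Filter.atTop

/-- A Følner sequence in `ℕ`. -/
def IsFolnerSeq (Φ : ℕ → Finset ℕ) : Prop :=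
  (∀ N, (Φ N).Nonempty) ∧
  ∀ t : ℕ, Filter.Tendsto
    (fun N => ((Φ N ∩ (Φ N).image (fun n => t + n)).card : ℝ) / ((Φ N).card : ℝ))
    Filter.atTop (nhds 1)

/-- `a` is `T`-generic for `μ` along the Følner sequence `Φ`: the empirical measures
along orbits converge to `μ` in the weak* topology. -/
def GenericAlong {X : Type*} [TopologicalSpace X] [MeasurableSpace X]
    (T : X → X) (μ : MeasureTheory.Measure X) (a : X) (Φ : ℕ → Finset ℕ) : Prop :=
  ∀ f : C(X, ℝ), Filter.Tendsto
    (fun N => (∑ n ∈ Φ N, f (T^[n] a)) / ((Φ N).card : ℝ))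
    Filter.atTop (nhds (∫ x, f x ∂μ))

/-- `(x₀, x₁, x₂)` is an `(ℓ,m)`-Erdős progression for `T`. -/
def ErdosProg {X : Type*} [TopologicalSpace X] (T : X → X) (ℓ m : ℕ)
    (x₀ x₁ x₂ : X) : Prop :=
  ∃ n : ℕ → ℕ, StrictMono n ∧ (∀ i, 0 < n i) ∧
    Filter.Tendsto (fun i => (T^[ℓ * n i] x₀, T^[m * n i] x₁)) Filter.atTop
      (nhds (x₁, x₂))


open Filter MeasureTheory Topology

/-! ### Bounded functions and means -/

/-- Bounded complex sequences. -/
def Bd (f : ℕ → ℂ) : Prop := ∃ C : ℝ, ∀ n, ‖f n‖ ≤ C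

/-- Bounded real sequences. -/
def BdR (f : ℕ → ℝ) : Prop := ∃ C : ℝ, ∀ n, |f n| ≤ C

lemma BdR.add {f g : ℕ → ℝ} (hf : BdR f) (hg : BdR g) : BdR (f + g) := by
  obtain ⟨C, hC⟩ := hf
  obtain ⟨D, hD⟩ := hg
  exact ⟨C + D, fun n => (abs_add_le _ _).trans (add_le_add (hC n) (hD n))⟩

lemma BdR.smul {f : ℕ → ℝ} (c : ℝ) (hf : BdR f) : BdR (c • f) := by
  obtain ⟨C, hC⟩ := hf
  refine ⟨|c| * C, fun n => ?_⟩
  simp only [Pi.smul_apply, smul_eq_mul, abs_mul]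
  exact mul_le_mul_of_nonneg_left (hC n) (abs_nonneg c)

lemma BdR.shift {f : ℕ → ℝ} (hf : BdR f) : BdR (fun n => f (n + 1)) := by
  obtain ⟨C, hC⟩ := hf
  exact ⟨C, fun n => hC _⟩

lemma BdR.one : BdR (fun _ => 1) := ⟨1, fun _ => by simp⟩

/-- Invariant means on real bounded sequences, as a subset of a product space. -/
def RMeans : Set ((ℕ → ℝ) → ℝ) :=
  {φ | (∀ f, ¬ BdR f → φ f = 0) ∧ (∀ f g, BdR f → BdR g → φ (f + g) = φ f + φ g) ∧
    (∀ (c : ℝ) (f), BdR f → φ (c • f) = c * φ f) ∧ (∀ f, BdR f → (∀ n, 0 ≤ f n) → 0 ≤ φ f) ∧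
    φ (fun _ => 1) = 1 ∧ ∀ f, BdR f → φ (fun n => f (n + 1)) = φ f}

lemma RMeans.le {φ : (ℕ → ℝ) → ℝ} (h : φ ∈ RMeans) {f g : ℕ → ℝ} (hf : BdR f) (hg : BdR g)
    (hfg : ∀ n, f n ≤ g n) : φ f ≤ φ g := by
  obtain ⟨h0, h1, h2, h3, h4, h5⟩ := h
  have hm : BdR ((-1 : ℝ) • f) := hf.smul _
  have := h3 (g + (-1 : ℝ) • f) (hg.add hm) (fun n => by simp [hfg n])
  rw [h1 _ _ hg hm, h2 _ _ hf] at this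
  linarith

lemma RMeans.abs_le {φ : (ℕ → ℝ) → ℝ} (h : φ ∈ RMeans) {f : ℕ → ℝ} (C : ℝ)
    (hC : ∀ n, |f n| ≤ C) : |φ f| ≤ C := by
  have hf : BdR f := ⟨C, hC⟩
  have e : ∀ c : ℝ, φ (c • fun _ => 1) = c := fun c => by
    rw [h.2.2.1 c _ BdR.one, h.2.2.2.2.1, mul_one]
  rw [_root_.abs_le]
  constructor
  · have := RMeans.le h (BdR.one.smul (-C)) hf (fun n => by
      have := (_root_.abs_le.1 (hC n)).1; simpa using this)
    rwa [e] at this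
  · have := RMeans.le h hf (BdR.one.smul C) (fun n => by
      have := (_root_.abs_le.1 (hC n)).2; simpa using this)
    rwa [e] at this

lemma RMeans.isCompact : IsCompact RMeans := by
  classical
  have : ∀ f : ℕ → ℝ, ∃ C : ℝ, BdR f → ∀ n, |f n| ≤ C := by
    intro f
    by_cases h : BdR f
    · exact ⟨h.choose, fun _ => h.choose_spec⟩
    · exact ⟨0, fun h' => absurd h' h⟩
  choose C hC using this
  have hK : IsCompact (Set.univ.pi fun f : ℕ → ℝ => Set.Icc (-|C f|) (|C f|)) :=
    isCompact_univ_pi fun f => isCompact_Icc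
  refine hK.of_isClosed_subset ?_ ?_
  · have ev : ∀ f : ℕ → ℝ, Continuous fun φ : (ℕ → ℝ) → ℝ => φ f := fun f => continuous_apply f
    unfold RMeans
    simp only [Set.ofPred_and, Set.ofPred_forall]
    refine IsClosed.inter ?_ (IsClosed.inter ?_ (IsClosed.inter ?_ (IsClosed.inter ?_
      (IsClosed.inter ?_ ?_))))
    · exact isClosed_iInter fun f => isClosed_iInter fun _ => isClosed_eq (ev f) continuous_const
    · exact isClosed_iInter fun f => isClosed_iInter fun g => isClosed_iInter fun _ =>
        isClosed_iInter fun _ => isClosed_eq (ev _) ((ev f).add (ev g))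
    · exact isClosed_iInter fun c => isClosed_iInter fun f => isClosed_iInter fun _ =>
        isClosed_eq (ev _) (continuous_const.mul (ev f))
    · exact isClosed_iInter fun f => isClosed_iInter fun _ => isClosed_iInter fun _ =>
        isClosed_le continuous_const (ev f)
    · exact isClosed_eq (ev _) continuous_const
    · exact isClosed_iInter fun f => isClosed_iInter fun _ => isClosed_eq (ev _) (ev _)
  · intro φ hφ f _
    rw [Set.mem_Icc, ← _root_.abs_le]
    by_cases h : BdR f
    · exact (RMeans.abs_le hφ _ (hC f h)).trans (le_abs_self _)
    · rw [hφ.1 f h]; simp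

/-- Existence of an ergodic (extreme) mean at which a given function has positive mean. -/
lemma RMeans.exists_extreme {a : ℕ → ℝ} {φ₀ : (ℕ → ℝ) → ℝ} (h₀ : φ₀ ∈ RMeans)
    (ha : 0 < φ₀ a) : ∃ φ ∈ RMeans, 0 < φ a ∧ ∀ ν : (ℕ → ℝ) → ℝ,
      (∀ f, ¬ BdR f → ν f = 0) → (∀ f g, BdR f → BdR g → ν (f + g) = ν f + ν g) →
      (∀ (c : ℝ) (f), BdR f → ν (c • f) = c * ν f) →
      (∀ f, BdR f → (∀ n, 0 ≤ f n) → 0 ≤ ν f) →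
      (∀ f, BdR f → (∀ n, 0 ≤ f n) → ν f ≤ φ f) →
      (∀ f, BdR f → ν (fun n => f (n + 1)) = ν f) →
      ∀ f, BdR f → ν f = ν (fun _ => 1) * φ f := by
  obtain ⟨ψ, hψ, hmax⟩ := RMeans.isCompact.exists_isMaxOn ⟨φ₀, h₀⟩
    (continuous_apply a).continuousOn
  have hmax' : ∀ φ ∈ RMeans, φ a ≤ ψ a := fun φ hφ => hmax hφ
  have hF : IsCompact (RMeans ∩ {φ | φ a = ψ a}) :=
    RMeans.isCompact.inter_right (isClosed_eq (continuous_apply a) continuous_const)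
  obtain ⟨φ, hφ⟩ := hF.extremePoints_nonempty ⟨ψ, hψ, rfl⟩
  obtain ⟨⟨hφS, hφa⟩, hext⟩ := hφ
  have hext' : ∀ x ∈ RMeans, ∀ y ∈ RMeans, φ ∈ openSegment ℝ x y → x = φ := by
    intro x hx y hy hxy
    obtain ⟨s, u, hs, hu, hsu, rfl⟩ := hxy
    have e : s * x a + u * y a = ψ a := by simpa using hφa
    have h1 := hmax' x hx
    have h2 := hmax' y hy
    have hxa : x a = ψ a := by
      refine le_antisymm h1 ?_
      by_contra hlt
      push Not at hlt
      nlinarith [mul_pos hs (sub_pos.2 hlt), mul_nonneg hu.le (sub_nonneg.2 h2), congrArg (· * ψ a) hsu]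
    have hya : y a = ψ a := by
      refine le_antisymm h2 ?_
      by_contra hlt
      push Not at hlt
      nlinarith [mul_pos hu (sub_pos.2 hlt), mul_nonneg hs.le (sub_nonneg.2 h1), congrArg (· * ψ a) hsu]
    exact (hext ⟨hx, hxa⟩ ⟨hy, hya⟩ ⟨s, u, hs, hu, hsu, rfl⟩)
  refine ⟨φ, hφS, ?_, ?_⟩
  · rw [hφa]; exact ha.trans_le (hmax' _ h₀)
  intro ν n0 n1 n2 n3 n4 n5 f hf
  obtain ⟨p0, p1, p2, p3, p4, p5⟩ := hφS
  set s := ν (fun _ => 1) with hs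
  have s0 : 0 ≤ s := n3 _ BdR.one (fun _ => zero_le_one)
  have s1 : s ≤ 1 := p4 ▸ n4 _ BdR.one (fun _ => zero_le_one)
  -- a positive functional vanishing at one vanishes
  have key : ∀ κ : (ℕ → ℝ) → ℝ, (∀ f g, BdR f → BdR g → κ (f + g) = κ f + κ g) →
      (∀ (c : ℝ) (f), BdR f → κ (c • f) = c * κ f) →
      (∀ f, BdR f → (∀ n, 0 ≤ f n) → 0 ≤ κ f) → κ (fun _ => 1) = 0 → κ f = 0 := by
    intro κ k1 k2 k3 k4
    obtain ⟨C, hC⟩ := hf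
    have hf : BdR f := ⟨C, hC⟩
    have b1 := k3 (C • (fun _ => 1) + f) ((BdR.one.smul C).add hf) (fun n => by
      have := (_root_.abs_le.1 (hC n)).1
      simp; linarith)
    have b2 := k3 (C • (fun _ => 1) + (-1 : ℝ) • f) ((BdR.one.smul C).add (hf.smul _)) (fun n => by
      have := (_root_.abs_le.1 (hC n)).2
      simp; linarith)
    rw [k1 _ _ (BdR.one.smul C) hf, k2 _ _ BdR.one, k4] at b1
    rw [k1 _ _ (BdR.one.smul C) (hf.smul _), k2 _ _ BdR.one, k4, k2 _ _ hf] at b2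
    linarith
  rcases s0.eq_or_lt with hs0 | hs0
  · rw [← hs0, zero_mul]
    exact key ν n1 n2 n3 (by rw [← hs, ← hs0])
  rcases s1.eq_or_lt with hs1 | hs1
  · have := key (fun g => φ g - ν g) (fun f g hf hg => by simp only [p1 f g hf hg, n1 f g hf hg]; ring)
      (fun c f hf => by simp only [p2 c f hf, n2 c f hf]; ring)
      (fun f hf h0 => sub_nonneg.2 (n4 f hf h0)) (by simp only [p4]; rw [← hs, hs1, sub_self])
    rw [hs1, one_mul]; linarith
  have hx : (fun g => s⁻¹ * ν g) ∈ RMeans := by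
    refine ⟨fun f hf => by simp [n0 f hf], fun f g hf hg => by simp only [n1 f g hf hg]; ring,
      fun c f hf => by simp only [n2 c f hf]; ring,
      fun f hf h => mul_nonneg (inv_nonneg.2 s0) (n3 f hf h), ?_, fun f hf => by simp only [n5 f hf]⟩
    simp only [← hs]; exact inv_mul_cancel₀ hs0.ne'
  have hy : (fun g => (1 - s)⁻¹ * (φ g - ν g)) ∈ RMeans := by
    refine ⟨fun f hf => by simp [n0 f hf, p0 f hf],
      fun f g hf hg => by simp only [n1 f g hf hg, p1 f g hf hg]; ring,
      fun c f hf => by simp only [n2 c f hf, p2 c f hf]; ring,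
      fun f hf h => mul_nonneg (inv_nonneg.2 (by linarith)) (sub_nonneg.2 (n4 f hf h)), ?_,
      fun f hf => by simp only [n5 f hf, p5 f hf]⟩
    simp only [← hs, p4]; exact inv_mul_cancel₀ (by linarith)
  have := hext' _ hx _ hy ⟨s, 1 - s, hs0, by linarith, by ring, by
    funext g
    simp only [Pi.add_apply, Pi.smul_apply, smul_eq_mul]
    have : (1 - s) ≠ 0 := by linarith
    field_simp
    ring⟩
  have := congrFun this f
  rw [← this]; field_simp

open Filter MeasureTheory Topology

lemma exists_hyper_lim (u : ℕ → ℝ) (C : ℝ) (hu : ∀ n, |u n| ≤ C) :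
    ∃ L, Tendsto u (hyperfilter ℕ : Filter ℕ) (𝓝 L) := by
  have hK : IsCompact (Set.Icc (-C) C) := isCompact_Icc
  obtain ⟨L, _, hL⟩ := hK.ultrafilter_le_nhds ((hyperfilter ℕ).map u) (by
    simp only [le_principal_iff]
    exact Filter.Eventually.of_forall (f := (hyperfilter ℕ : Filter ℕ)) fun n => abs_le.1 (hu n))
  exact ⟨L, hL⟩

lemma exists_windows (A : Set ℕ) (hA : 0 < upperBanachDensity A) :
    ∃ δ : ℝ, 0 < δ ∧ ∀ n : ℕ, ∃ N s : ℕ, n < N ∧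
      δ * N ≤ ∑ k ∈ Finset.Ico s (s + N), A.indicator (fun _ => (1 : ℝ)) k := by
  classical
  refine ⟨upperBanachDensity A / 2, by linarith, fun n => ?_⟩
  have hlt : upperBanachDensity A / 2 < upperBanachDensity A := by linarith
  have hle : ∀ N s : ℕ, (((Finset.Ico s (s + N)).filter (· ∈ A)).card : ℝ) / N ≤ 1 := by
    intro N s
    refine div_le_one_of_le₀ ?_ (Nat.cast_nonneg _)
    have := (Finset.card_filter_le (Finset.Ico s (s + N)) (· ∈ A))
    rw [Nat.card_Ico, Nat.add_sub_cancel_left] at this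
    exact_mod_cast this
  have hf : ∃ᶠ N : ℕ in atTop, upperBanachDensity A / 2 <
      ⨆ M : ℕ, (((Finset.Ico M (M + N)).filter (· ∈ A)).card : ℝ) / N := by
    refine frequently_lt_of_lt_limsup ?_ ?_
    · refine IsCoboundedUnder.of_frequently_ge (a := 0) (Eventually.frequently (Eventually.of_forall fun N => ?_))
      exact Real.iSup_nonneg fun s => by positivity
    · unfold upperBanachDensity at hlt ⊢
      convert hlt using 4
  obtain ⟨N, h, hN⟩ := (hf.and_eventually (eventually_gt_atTop n)).exists
  obtain ⟨s, hs⟩ := exists_lt_of_lt_ciSup h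
  refine ⟨N, s, hN, ?_⟩
  have hN0 : (0 : ℝ) < N := by exact_mod_cast (by omega : 0 < N)
  rw [lt_div_iff₀ hN0] at hs
  refine hs.le.trans (le_of_eq ?_)
  simp only [Set.indicator_apply, Finset.sum_boole]

lemma exists_init (ℓ : ℕ) (hℓ : 0 < ℓ) (A : Set ℕ) (hA : 0 < upperBanachDensity A) :
    ∃ φ ∈ RMeans, 0 < φ (fun N => ∑ k ∈ Finset.range ℓ, A.indicator (fun _ => (1 : ℝ)) (ℓ * N + k)) := by
  classical
  obtain ⟨δ, hδ, hw⟩ := exists_windows A hA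
  choose N s hN hs using hw
  have hN0 : ∀ i, (0 : ℝ) < N i := fun i => by exact_mod_cast (by have := hN i; omega : 0 < N i)
  let avg : (ℕ → ℝ) → ℕ → ℝ := fun f i => (∑ k ∈ Finset.Ico (s i) (s i + N i), f (k / ℓ)) / N i
  have avg_def : ∀ f i, avg f i = (∑ k ∈ Finset.Ico (s i) (s i + N i), f (k / ℓ)) / N i :=
    fun _ _ => rfl
  have hb : ∀ f C, (∀ n, |f n| ≤ C) → ∀ i, |avg f i| ≤ C := by
    intro f C hC i
    rw [avg_def, abs_div, abs_of_pos (hN0 i), div_le_iff₀ (hN0 i)]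
    refine (Finset.abs_sum_le_sum_abs _ _).trans ((Finset.sum_le_card_nsmul _ _ C fun k _ => hC _).trans ?_)
    simp [mul_comm]
  let φ : (ℕ → ℝ) → ℝ := fun f => if BdR f then limUnder (hyperfilter ℕ : Filter ℕ) (avg f) else 0
  have hφ : ∀ f, BdR f → Tendsto (avg f) (hyperfilter ℕ : Filter ℕ) (𝓝 (φ f)) := by
    intro f hf
    obtain ⟨C, hC⟩ := id hf
    obtain ⟨L, hL⟩ := exists_hyper_lim (avg f) C (hb f C hC)
    have : φ f = L := by simp only [φ, if_pos hf]; exact hL.limUnder_eq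
    rwa [this]
  have hNinf : Tendsto (fun i => (N i : ℝ)) (hyperfilter ℕ : Filter ℕ) atTop := by
    refine Tendsto.mono_left (tendsto_natCast_atTop_atTop.comp
      (tendsto_atTop_mono (fun i => (hN i).le) tendsto_id)) Nat.hyperfilter_le_atTop
  have hmem : φ ∈ RMeans := by
    refine ⟨fun f hf => by simp [φ, hf], fun f g hf hg => ?_, fun c f hf => ?_, fun f hf h0 => ?_, ?_,
      fun f hf => ?_⟩
    · refine tendsto_nhds_unique (hφ _ (hf.add hg)) (((hφ f hf).add (hφ g hg)).congr fun i => ?_)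
      simp [avg_def, Finset.sum_add_distrib, add_div]
    · refine tendsto_nhds_unique (hφ _ (hf.smul c)) (((hφ f hf).const_mul c).congr fun i => ?_)
      simp only [avg, Pi.smul_apply, smul_eq_mul]
      rw [← Finset.mul_sum, mul_div_assoc]
    · refine ge_of_tendsto' (hφ f hf) fun i => ?_
      exact div_nonneg (Finset.sum_nonneg fun k _ => h0 _) (hN0 i).le
    · refine tendsto_nhds_unique (hφ _ BdR.one) ((tendsto_const_nhds (x := (1 : ℝ))).congr fun i => ?_)
      have := (hN0 i).ne'
      simp [avg_def, this]
    · have h1 := (hφ _ hf.shift).sub (hφ f hf)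
      obtain ⟨C, hC⟩ := id hf
      have h2 : Tendsto (fun i => avg (fun n => f (n + 1)) i - avg f i) (hyperfilter ℕ : Filter ℕ)
          (𝓝 0) := by
        have hz : Tendsto (fun i => (2 * ℓ * C) / (N i : ℝ)) (hyperfilter ℕ : Filter ℕ) (𝓝 0) :=
          tendsto_const_nhds.div_atTop hNinf
        refine squeeze_zero_norm (fun i => ?_) hz
        simp only [avg]
        rw [← sub_div, norm_div, Real.norm_of_nonneg (hN0 i).le]
        refine div_le_div_of_nonneg_right ?_ (hN0 i).le
        have e1 : ∀ k, f (k / ℓ + 1) = f ((k + ℓ) / ℓ) := fun k => by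
          rw [Nat.add_div_right _ hℓ]
        simp_rw [e1]
        rw [Finset.sum_Ico_add' (fun k => f (k / ℓ))]
        have c1 := Finset.sum_Ico_consecutive (fun k => f (k / ℓ)) (Nat.le_add_right (s i) (N i))
          (Nat.le_add_right (s i + N i) ℓ)
        have c2 := Finset.sum_Ico_consecutive (fun k => f (k / ℓ)) (Nat.le_add_right (s i) ℓ)
          (by omega : s i + ℓ ≤ s i + N i + ℓ)
        have b : ∀ r, |∑ k ∈ Finset.Ico r (r + ℓ), f (k / ℓ)| ≤ ℓ * C := by
          intro r
          refine (Finset.abs_sum_le_sum_abs _ _).trans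
            ((Finset.sum_le_card_nsmul _ _ C fun k _ => hC _).trans ?_)
          simp
        have b1 := abs_le.1 (b (s i))
        have b2 := abs_le.1 (b (s i + N i))
        rw [Real.norm_eq_abs, abs_le]
        constructor <;> linarith
      have := tendsto_nhds_unique h1 h2
      linarith
  refine ⟨φ, hmem, ?_⟩
  have hbd : BdR (fun N => ∑ k ∈ Finset.range ℓ, A.indicator (fun _ => (1 : ℝ)) (ℓ * N + k)) := by
    refine ⟨ℓ, fun n => ?_⟩
    refine (Finset.abs_sum_le_sum_abs _ _).trans
            ((Finset.sum_le_card_nsmul _ _ 1 fun k _ => ?_).trans ?_)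
    · by_cases h : (ℓ * n + k) ∈ A <;> simp [h]
    · simp
  refine hδ.trans_le (ge_of_tendsto' (hφ _ hbd) fun i => ?_)
  simp only [avg]
  rw [le_div_iff₀ (hN0 i)]
  refine (hs i).trans (Finset.sum_le_sum fun k _ => ?_)
  have hk : k % ℓ ∈ Finset.range ℓ := Finset.mem_range.2 (Nat.mod_lt _ hℓ)
  have := Finset.single_le_sum (f := fun j => A.indicator (fun _ => (1 : ℝ)) (ℓ * (k / ℓ) + j))
    (fun j _ => Set.indicator_nonneg (fun _ _ => zero_le_one) _) hk
  simp only [Nat.div_add_mod] at this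
  exact this

open Filter MeasureTheory Topology
open scoped ComplexOrder ComplexConjugate

lemma Bd.add {f g : ℕ → ℂ} (hf : Bd f) (hg : Bd g) : Bd (f + g) := by
  obtain ⟨C, hC⟩ := hf
  obtain ⟨D, hD⟩ := hg
  exact ⟨C + D, fun n => (norm_add_le _ _).trans (add_le_add (hC n) (hD n))⟩

lemma Bd.smul {f : ℕ → ℂ} (c : ℂ) (hf : Bd f) : Bd (c • f) := by
  obtain ⟨C, hC⟩ := hf
  refine ⟨‖c‖ * C, fun n => ?_⟩
  simp only [Pi.smul_apply, smul_eq_mul, norm_mul]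
  exact mul_le_mul_of_nonneg_left (hC n) (norm_nonneg c)

lemma Bd.mul {f g : ℕ → ℂ} (hf : Bd f) (hg : Bd g) : Bd (fun n => f n * g n) := by
  obtain ⟨C, hC⟩ := hf
  obtain ⟨D, hD⟩ := hg
  exact ⟨C * D, fun n => (norm_mul_le _ _).trans (mul_le_mul (hC n) (hD n) (norm_nonneg _)
    ((norm_nonneg _).trans (hC n)))⟩

lemma Bd.conj {f : ℕ → ℂ} (hf : Bd f) : Bd (fun n => conj (f n)) := by
  obtain ⟨C, hC⟩ := hf
  exact ⟨C, fun n => by simpa using hC n⟩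

lemma Bd.comp {f : ℕ → ℂ} (hf : Bd f) (σ : ℕ → ℕ) : Bd (fun n => f (σ n)) := by
  obtain ⟨C, hC⟩ := hf
  exact ⟨C, fun n => hC _⟩

lemma Bd.const (c : ℂ) : Bd (fun _ => c) := ⟨‖c‖, fun _ => le_rfl⟩

lemma Bd.neg {f : ℕ → ℂ} (hf : Bd f) : Bd (-f) := by
  have := hf.smul (-1); simpa using this

lemma Bd.sub {f g : ℕ → ℂ} (hf : Bd f) (hg : Bd g) : Bd (f - g) := by
  rw [sub_eq_add_neg]; exact hf.add hg.neg

lemma Bd.sum {ι : Type*} (s : Finset ι) (f : ι → ℕ → ℂ) (h : ∀ i ∈ s, Bd (f i)) :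
    Bd (∑ i ∈ s, f i) := by
  classical
  induction s using Finset.induction_on with
  | empty => exact ⟨0, fun n => by simp⟩
  | insert a s ha ih =>
    rw [Finset.sum_insert ha]
    exact (h a (by simp)).add (ih fun i hi => h i (by simp [hi]))

lemma Bd.ofReal {f : ℕ → ℝ} (hf : BdR f) : Bd (fun n => (f n : ℂ)) := by
  obtain ⟨C, hC⟩ := hf
  exact ⟨C, fun n => by simpa using hC n⟩

lemma Bd.re {f : ℕ → ℂ} (hf : Bd f) : BdR (fun n => (f n).re) := by
  obtain ⟨C, hC⟩ := hf
  exact ⟨C, fun n => (Complex.abs_re_le_norm _).trans (hC n)⟩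

lemma Bd.im {f : ℕ → ℂ} (hf : Bd f) : BdR (fun n => (f n).im) := by
  obtain ⟨C, hC⟩ := hf
  exact ⟨C, fun n => (Complex.abs_im_le_norm _).trans (hC n)⟩

/-- The submodule of bounded sequences. -/
def BSub : Submodule ℂ (ℕ → ℂ) where
  carrier := {f | Bd f}
  add_mem' := Bd.add
  zero_mem' := ⟨0, fun n => by simp⟩
  smul_mem' := fun c _ hf => Bd.smul c hf

/-- Positivity, normalisation, invariance of a complex mean. -/
structure IsMean (M : (ℕ → ℂ) →ₗ[ℂ] ℂ) : Prop where
  pos : ∀ f, Bd f → (∀ n, 0 ≤ f n) → 0 ≤ M f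
  one : M (fun _ => 1) = 1
  shift : ∀ f, Bd f → M (fun n => f (n + 1)) = M f

lemma RMeans.exists_complex {φ : (ℕ → ℝ) → ℝ} (h : φ ∈ RMeans) :
    ∃ M : (ℕ → ℂ) →ₗ[ℂ] ℂ, IsMean M ∧ ∀ f, BdR f → M (fun n => (f n : ℂ)) = φ f := by
  obtain ⟨h0, h1, h2, h3, h4, h5⟩ := h
  have neg : ∀ f, BdR f → φ (fun n => - f n) = - φ f := fun f hf => by
    have := h2 (-1) f hf
    have e : ((-1 : ℝ) • f) = fun n => - f n := by funext n; simp
    rw [e] at this; linarith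
  let M0 : BSub →ₗ[ℂ] ℂ :=
    { toFun := fun f => (φ (fun n => (f.1 n).re) : ℂ) + (φ (fun n => (f.1 n).im) : ℂ) * Complex.I
      map_add' := by
        rintro ⟨f, hf⟩ ⟨g, hg⟩
        have e1 := h1 _ _ (Bd.re hf) (Bd.re hg)
        have e2 := h1 _ _ (Bd.im hf) (Bd.im hg)
        simp only [Pi.add_def] at e1 e2
        simp only [Submodule.coe_add, Pi.add_apply, Complex.add_re, Complex.add_im, e1, e2]
        push_cast
        ring
      map_smul' := by
        rintro c ⟨f, hf⟩
        have hr := Bd.re hf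
        have hi := Bd.im hf
        have e1 := h1 _ _ (hr.smul c.re) (hi.smul (-c.im))
        have e2 := h1 _ _ (hi.smul c.re) (hr.smul c.im)
        rw [h2 _ _ hr, h2 _ _ hi] at e1 e2
        simp only [Pi.add_def, Pi.smul_apply, smul_eq_mul] at e1 e2
        have e3 : (fun n => ((c • f) n).re) = fun n => c.re * (f n).re + -c.im * (f n).im := by
          funext n; simp [Complex.mul_re]; ring
        have e4 : (fun n => ((c • f) n).im) = fun n => c.re * (f n).im + c.im * (f n).re := by
          funext n; simp [Complex.mul_im]
        simp only [Submodule.coe_smul, e3, e4, e1, e2, RingHom.id_apply, smul_eq_mul]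
        apply Complex.ext <;> simp <;> ring }
  obtain ⟨M, hM⟩ := M0.exists_extend
  have hM' : ∀ f, Bd f → M f = (φ (fun n => (f n).re) : ℂ) + (φ (fun n => (f n).im) : ℂ) * Complex.I :=
    fun f hf => by
      have := LinearMap.congr_fun hM (⟨f, hf⟩ : BSub)
      exact this
  have z : φ (fun _ => 0) = 0 := by
    have := h2 0 _ BdR.one
    have e : ((0 : ℝ) • fun _ => 1 : ℕ → ℝ) = fun n => 0 := by funext n; simp
    rw [e] at this; linarith
  have hr : ∀ f, BdR f → M (fun n => (f n : ℂ)) = φ f := fun f hf => by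
    rw [hM' _ (Bd.ofReal hf)]
    simp [z]
  refine ⟨M, ⟨fun f hf h => ?_, ?_, fun f hf => ?_⟩, hr⟩
  · have e : f = fun n => ((f n).re : ℂ) := by
      funext n
      have := (Complex.le_def.1 (h n)).2
      apply Complex.ext
      · simp
      · simpa using this.symm
    rw [e, hr _ (Bd.re hf)]
    have := h3 _ (Bd.re hf) (fun n => (Complex.le_def.1 (h n)).1)
    exact_mod_cast this
  · have := hr _ BdR.one
    rw [h4] at this
    simpa using this
  · rw [hM' f hf, hM' _ (hf.comp (· + 1)), h5 _ hf.re, h5 _ hf.im]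

namespace IsMean
variable {M : (ℕ → ℂ) →ₗ[ℂ] ℂ}

lemma real (hM : IsMean M) {f : ℕ → ℝ} (hf : BdR f) : (M (fun n => (f n : ℂ))).im = 0 := by
  obtain ⟨C, hC⟩ := id hf
  have h1 := hM.pos ((fun n => (f n : ℂ)) + (C : ℂ) • fun _ => 1)
    ((Bd.ofReal hf).add ((Bd.const 1).smul _)) (fun n => by
      have := (abs_le.1 (hC n)).1
      simp only [Pi.add_apply, Pi.smul_apply, smul_eq_mul, mul_one]
      norm_cast; linarith)
  rw [map_add, map_smul, hM.one] at h1
  simpa using ((Complex.le_def.1 h1).2).symm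

lemma map_conj (hM : IsMean M) {f : ℕ → ℂ} (hf : Bd f) : M (fun n => conj (f n)) = conj (M f) := by
  have e1 : f = (fun n => ((f n).re : ℂ)) + Complex.I • fun n => ((f n).im : ℂ) := by
    funext n; apply Complex.ext <;> simp
  have e2 : (fun n => (starRingEnd ℂ) (f n)) = (fun n => ((f n).re : ℂ)) - Complex.I • fun n => ((f n).im : ℂ) := by
    funext n; apply Complex.ext <;> simp
  rw [e2]
  conv_rhs => rw [e1]
  simp only [map_add, map_sub, map_smul, smul_eq_mul, map_mul, Complex.conj_I]
  rw [Complex.conj_eq_iff_im.2 (hM.real hf.re), Complex.conj_eq_iff_im.2 (hM.real hf.im)]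
  ring
end IsMean

set_option linter.unusedVariables false in
/-- Bounded sequences with the pre-inner product given by the mean. -/
def PreH (M : (ℕ → ℂ) →ₗ[ℂ] ℂ) (hM : IsMean M) : Type := BSub

section
variable (M : (ℕ → ℂ) →ₗ[ℂ] ℂ) (hM : IsMean M)

instance : AddCommGroup (PreH M hM) := inferInstanceAs (AddCommGroup BSub)
instance : Module ℂ (PreH M hM) := inferInstanceAs (Module ℂ BSub)

/-- Identification. -/
def toPreH : BSub ≃ₗ[ℂ] PreH M hM := LinearEquiv.refl ℂ _

/-- The pre-inner product. -/
noncomputable abbrev preHCore : PreInnerProductSpace.Core ℂ (PreH M hM) where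
  inner a b := M (fun n => starRingEnd ℂ (((toPreH M hM).symm a).1 n) * ((toPreH M hM).symm b).1 n)
  conj_inner_symm := fun a b => by
    have ha : Bd ((toPreH M hM).symm a).1 := ((toPreH M hM).symm a).2
    have hb : Bd ((toPreH M hM).symm b).1 := ((toPreH M hM).symm b).2
    rw [← hM.map_conj (hb.conj.mul ha)]
    congr 1
    funext n
    simp [mul_comm]
  re_inner_nonneg := fun a => by
    have ha : Bd ((toPreH M hM).symm a).1 := ((toPreH M hM).symm a).2
    have := hM.pos _ (ha.conj.mul ha) (fun n => by
      rw [Complex.conj_mul']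
      positivity)
    exact (Complex.le_def.1 this).1
  add_left := fun a b c => by
    rw [← map_add]
    congr 1
    funext n
    simp [add_mul]
  smul_left := fun a b r => by
    rw [← smul_eq_mul, ← map_smul]
    congr 1
    funext n
    simp [mul_assoc]

noncomputable instance : SeminormedAddCommGroup (PreH M hM) :=
  InnerProductSpace.Core.toSeminormedAddCommGroup (c := preHCore M hM)
noncomputable instance : InnerProductSpace ℂ (PreH M hM) :=
  InnerProductSpace.ofCore (preHCore M hM)

end

/-- A Hilbert space model of a mean. -/
structure IsModel {H : Type} [NormedAddCommGroup H] [InnerProductSpace ℂ H] 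
    (M : (ℕ → ℂ) →ₗ[ℂ] ℂ) (V : (ℕ → ℂ) →ₗ[ℂ] H) : Prop extends IsMean M where
  inn : ∀ f g, Bd f → Bd g → inner ℂ (V f) (V g) = M (fun n => conj (f n) * g n)
  dense : DenseRange (fun f : BSub => V f.1)

lemma IsMean.exists_model {M : (ℕ → ℂ) →ₗ[ℂ] ℂ} (hM : IsMean M) :
    ∃ (H : Type) (_ : NormedAddCommGroup H) (_ : InnerProductSpace ℂ H) (_ : CompleteSpace H)
      (V : (ℕ → ℂ) →ₗ[ℂ] H), IsModel M V := by
  obtain ⟨V, hV⟩ := LinearMap.exists_extend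
    ((UniformSpace.Completion.toComplₗᵢ (𝕜 := ℂ) (E := PreH M hM)).toLinearMap ∘ₗ (toPreH M hM).toLinearMap)
  have hV' : ∀ f : BSub, V f.1 = ((toPreH M hM f : PreH M hM) : UniformSpace.Completion (PreH M hM)) :=
    fun f => LinearMap.congr_fun hV f
  refine ⟨UniformSpace.Completion (PreH M hM), inferInstance, inferInstance, inferInstance, V, hM, ?_, ?_⟩
  · intro f g hf hg
    have e1 := hV' ⟨f, hf⟩
    have e2 := hV' ⟨g, hg⟩
    simp only at e1 e2
    rw [e1, e2, UniformSpace.Completion.inner_coe]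
    rfl
  · have e : (fun f : BSub => V f.1) =
      (fun x : PreH M hM => (x : UniformSpace.Completion (PreH M hM))) ∘ (toPreH M hM) := funext hV'
    rw [e]
    exact UniformSpace.Completion.denseRange_coe.comp (toPreH M hM).surjective.denseRange
      (UniformSpace.Completion.continuous_coe _)

open Filter MeasureTheory Topology
open scoped ComplexOrder ComplexConjugate

/-- The character. -/
def ch (z : Circle) : ℕ → ℂ := fun n => (z : ℂ) ^ n

lemma norm_ch (z : Circle) (n : ℕ) : ‖ch z n‖ = 1 := by
  rw [ch, norm_pow, Circle.norm_coe, one_pow]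

lemma Bd.ch (z : Circle) : Bd (ch z) := ⟨1, fun n => (norm_ch z n).le⟩

namespace IsModel
variable {H : Type} [NormedAddCommGroup H] [InnerProductSpace ℂ H]
  {M : (ℕ → ℂ) →ₗ[ℂ] ℂ} {V : (ℕ → ℂ) →ₗ[ℂ] H}

lemma norm_sq (hV : IsModel M V) {f : ℕ → ℂ} (hf : Bd f) :
    ((‖V f‖ ^ 2 : ℝ) : ℂ) = M (fun n => ((‖f n‖ ^ 2 : ℝ) : ℂ)) := by
  have := hV.inn f f hf hf
  rw [inner_self_eq_norm_sq_to_K] at this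
  push_cast
  rw [show ((‖V f‖ : ℂ)) ^ 2 = _ from this]
  congr 1
  funext n
  rw [Complex.conj_mul']

lemma mono (hV : IsModel M V) {f g : ℕ → ℂ} (hf : Bd f) (hg : Bd g) (h : ∀ n, f n ≤ g n) :
    M f ≤ M g := by
  have := hV.pos (g - f) (hg.sub hf) (fun n => by simpa using h n)
  simpa using this

lemma const (hV : IsModel M V) (c : ℂ) : M (fun _ => c) = c := by
  have := map_smul M c (fun _ => 1)
  rw [hV.one] at this
  rw [show (fun _ : ℕ => c) = c • (fun _ => 1) by funext n; simp, this]
  simp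

lemma norm_V_le (hV : IsModel M V) {f : ℕ → ℂ} {C : ℝ} (hC : ∀ n, ‖f n‖ ≤ C) : ‖V f‖ ≤ C := by
  have hC0 : 0 ≤ C := (norm_nonneg _).trans (hC 0)
  have hf : Bd f := ⟨C, hC⟩
  have h1 := hV.norm_sq hf
  have h2 := hV.mono (f := fun n => ((‖f n‖ ^ 2 : ℝ) : ℂ)) (g := fun n => ((C ^ 2 : ℝ) : ℂ))
    ⟨C ^ 2, fun n => by simpa using pow_le_pow_left₀ (norm_nonneg _) (hC n) 2⟩ (Bd.const _)
    (fun n => by exact_mod_cast pow_le_pow_left₀ (norm_nonneg _) (hC n) 2)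
  rw [← h1, hV.const] at h2
  have h3 : ‖V f‖ ^ 2 ≤ C ^ 2 := by exact_mod_cast h2
  exact le_of_sq_le_sq h3 hC0

lemma M_eq (hV : IsModel M V) {f : ℕ → ℂ} (hf : Bd f) : M f = inner ℂ (V fun _ => 1) (V f) := by
  rw [hV.inn _ _ (Bd.const 1) hf]; simp

lemma norm_V_one (hV : IsModel M V) : ‖V fun _ => 1‖ = 1 := by
  have := hV.norm_sq (Bd.const 1)
  simp only [norm_one, one_pow, Complex.ofReal_one, hV.one] at this
  have h2 : ‖V fun _ => 1‖ ^ 2 = 1 := by exact_mod_cast this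
  nlinarith [norm_nonneg (V fun _ => 1)]

lemma norm_M_le_V (hV : IsModel M V) {f : ℕ → ℂ} (hf : Bd f) : ‖M f‖ ≤ ‖V f‖ := by
  rw [hV.M_eq hf]
  refine (norm_inner_le_norm _ _).trans ?_
  rw [hV.norm_V_one, one_mul]

lemma norm_M_le (hV : IsModel M V) {f : ℕ → ℂ} {C : ℝ} (hC : ∀ n, ‖f n‖ ≤ C) : ‖M f‖ ≤ C :=
  (hV.norm_M_le_V ⟨C, hC⟩).trans (hV.norm_V_le hC)

lemma norm_V_congr (hV : IsModel M V) {f g : ℕ → ℂ} (hf : Bd f) (hg : Bd g)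
    (h : ∀ n, ‖f n‖ = ‖g n‖) : ‖V f‖ = ‖V g‖ := by
  have h1 := hV.norm_sq hf
  have h2 := hV.norm_sq hg
  simp only [h] at h1
  rw [← h2] at h1
  have : ‖V f‖ ^ 2 = ‖V g‖ ^ 2 := by exact_mod_cast h1
  exact (sq_eq_sq₀ (norm_nonneg _) (norm_nonneg _)).1 this

lemma norm_V_mono (hV : IsModel M V) {f g : ℕ → ℂ} (hf : Bd f) (hg : Bd g)
    (h : ∀ n, ‖f n‖ ≤ ‖g n‖) : ‖V f‖ ≤ ‖V g‖ := by
  have h1 := hV.norm_sq hf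
  have h2 := hV.norm_sq hg
  have hb : ∀ f, Bd f → Bd fun n => ((‖f n‖ ^ 2 : ℝ) : ℂ) := fun f ⟨C, hC⟩ =>
    ⟨C ^ 2, fun n => by simpa using pow_le_pow_left₀ (norm_nonneg _) (hC n) 2⟩
  have := hV.mono (hb f hf) (hb g hg) (fun n => by
    exact_mod_cast pow_le_pow_left₀ (norm_nonneg _) (h n) 2)
  rw [← h1, ← h2] at this
  have : ‖V f‖ ^ 2 ≤ ‖V g‖ ^ 2 := by exact_mod_cast this
  exact le_of_sq_le_sq this (norm_nonneg _)

/-- Extending an isometry of bounded sequences. -/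
lemma exists_isom [CompleteSpace H] (hV : IsModel M V) (σ : (ℕ → ℂ) →ₗ[ℂ] (ℕ → ℂ)) (hσ : ∀ f, Bd f → Bd (σ f))
    (hn : ∀ f, Bd f → ‖V (σ f)‖ = ‖V f‖) (hs : ∀ g, Bd g → ∃ f, Bd f ∧ V (σ f) = V g) :
    ∃ T : H ≃ₗᵢ[ℂ] H, ∀ f, Bd f → T (V f) = V (σ f) := by
  let e : BSub →ₗ[ℂ] H := V ∘ₗ BSub.subtype
  let e2 : BSub →ₗ[ℂ] H := V ∘ₗ σ ∘ₗ BSub.subtype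
  have hd : DenseRange e := hV.dense
  have hnorm : ∀ x, ‖e2 x‖ = ‖e x‖ := fun x => hn x.1 x.2
  let T0 : H →L[ℂ] H := e2.extendOfNorm e
  have hT0 : ∀ x, T0 (e x) = e2 x := fun x =>
    LinearMap.extendOfNorm_eq hd ⟨1, fun x => by rw [hnorm, one_mul]⟩ x
  have hiso : ∀ v, ‖T0 v‖ = ‖v‖ := by
    refine fun v => hd.induction (P := fun v => ‖T0 v‖ = ‖v‖) ?_ (isClosed_eq (by fun_prop) continuous_norm) v
    rintro _ ⟨y, rfl⟩
    rw [hT0, hnorm]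
  let T1 : H →ₗᵢ[ℂ] H := ⟨T0.toLinearMap, hiso⟩
  have hsurj : Function.Surjective T1 := by
    have hcl : IsClosed (Set.range T1) := T1.isometry.isClosedEmbedding.isClosed_range
    have hdr : DenseRange T1 := by
      refine Dense.mono ?_ hd
      rintro _ ⟨y, rfl⟩
      obtain ⟨f, hf, h⟩ := hs y.1 y.2
      exact ⟨e ⟨f, hf⟩, (hT0 ⟨f, hf⟩).trans h⟩
    intro v
    have := hdr v
    rwa [hcl.closure_eq] at this
  refine ⟨LinearIsometryEquiv.ofSurjective T1 hsurj, fun f hf => hT0 ⟨f, hf⟩⟩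

lemma exists_shift [CompleteSpace H] (hV : IsModel M V) :
    ∃ T : H ≃ₗᵢ[ℂ] H, ∀ f, Bd f → T (V f) = V (fun n => f (n + 1)) := by
  refine hV.exists_isom (LinearMap.funLeft ℂ ℂ (· + 1)) (fun f hf => hf.comp _) (fun f hf => ?_)
    (fun g hg => ⟨fun n => g (n - 1), hg.comp _, ?_⟩)
  · have h1 := hV.norm_sq hf
    have h2 := hV.norm_sq (hf.comp (· + 1))
    have hb : Bd fun n => ((‖f n‖ ^ 2 : ℝ) : ℂ) := by
      obtain ⟨C, hC⟩ := hf
      exact ⟨C ^ 2, fun n => by simpa using pow_le_pow_left₀ (norm_nonneg _) (hC n) 2⟩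
    rw [hV.shift _ hb, ← h1] at h2
    have : ‖V (fun n => f (n + 1))‖ ^ 2 = ‖V f‖ ^ 2 := by exact_mod_cast h2
    exact (sq_eq_sq₀ (norm_nonneg _) (norm_nonneg _)).1 this
  · congr 1

lemma exists_mulch [CompleteSpace H] (hV : IsModel M V) (z : Circle) :
    ∃ T : H ≃ₗᵢ[ℂ] H, ∀ f, Bd f → T (V f) = V (fun n => ch z n * f n) := by
  refine hV.exists_isom (LinearMap.mulLeft ℂ (ch z)) (fun f hf => (Bd.ch z).mul hf) (fun f hf => ?_)
    (fun g hg => ⟨fun n => ch z⁻¹ n * g n, (Bd.ch _).mul hg, ?_⟩)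
  · refine hV.norm_V_congr ((Bd.ch z).mul hf) hf (fun n => ?_)
    simp [norm_ch]
  · congr 1
    funext n
    simp only [LinearMap.mulLeft_apply, Pi.mul_apply, ← mul_assoc, ch, Circle.coe_inv, inv_pow]
    rw [mul_inv_cancel₀ (by simp), one_mul]

end IsModel

/-- An ergodic Hilbert space model. -/
structure IsSys {H : Type} [NormedAddCommGroup H] [InnerProductSpace ℂ H]
    (M : (ℕ → ℂ) →ₗ[ℂ] ℂ) (V : (ℕ → ℂ) →ₗ[ℂ] H) (T : H ≃ₗᵢ[ℂ] H) : Prop extends IsModel M V where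
  T_V : ∀ f, Bd f → T (V f) = V (fun n => f (n + 1))
  erg : ∀ v, T v = v → ∃ c : ℂ, v = c • V (fun _ => 1)

lemma erg_of_extreme {H : Type} [NormedAddCommGroup H] [InnerProductSpace ℂ H] [CompleteSpace H]
    {M : (ℕ → ℂ) →ₗ[ℂ] ℂ} {V : (ℕ → ℂ) →ₗ[ℂ] H} {T : H ≃ₗᵢ[ℂ] H} {φ : (ℕ → ℝ) → ℝ} (hφ : φ ∈ RMeans)
    (hMφ : ∀ f, BdR f → M (fun n => (f n : ℂ)) = φ f) (hV : IsModel M V)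
    (hT : ∀ f, Bd f → T (V f) = V (fun n => f (n + 1)))
    (hext : ∀ ν : (ℕ → ℝ) → ℝ,
      (∀ f, ¬ BdR f → ν f = 0) → (∀ f g, BdR f → BdR g → ν (f + g) = ν f + ν g) →
      (∀ (c : ℝ) (f), BdR f → ν (c • f) = c * ν f) →
      (∀ f, BdR f → (∀ n, 0 ≤ f n) → 0 ≤ ν f) →
      (∀ f, BdR f → (∀ n, 0 ≤ f n) → ν f ≤ φ f) →
      (∀ f, BdR f → ν (fun n => f (n + 1)) = ν f) →
      ∀ f, BdR f → ν f = ν (fun _ => 1) * φ f) :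
    ∀ v, T v = v → ∃ c : ℂ, v = c • V (fun _ => 1) := by
  classical
  let Tc : H →L[ℂ] H := (T : H →L[ℂ] H)
  have hTc : ∀ v, Tc v = T v := fun _ => rfl
  have hTn : ‖Tc‖ ≤ 1 := Tc.opNorm_le_bound zero_le_one (fun v => by rw [hTc, T.norm_map, one_mul])
  set E : Submodule ℂ H := Tc.eqLocus (1 : H →L[ℂ] H) with hE
  have hEc : CompleteSpace E := by infer_instance
  have hEmem : ∀ v, v ∈ E ↔ T v = v := fun v => Iff.rfl
  let S : Submodule ℂ H := Submodule.span ℂ {V fun _ => 1}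
  have hiter : ∀ f, Bd f → ∀ k, Tc^[k] (V f) = V (fun n => f (n + k)) := by
    intro f hf k
    induction k with
    | zero => simp
    | succ k ih =>
      rw [Function.iterate_succ_apply', ih, hTc, hT _ (hf.comp (· + k))]
      congr 1; funext n; congr 1; ring
  -- the main claim
  have claim : ∀ f : ℕ → ℝ, (∀ n, 0 ≤ f n) → (∀ n, f n ≤ 1) →
      E.starProjection (V fun n => (f n : ℂ)) ∈ S := by
    intro f hf0 hf1
    have hfb : BdR f := ⟨1, fun n => abs_le.2 ⟨by linarith [hf0 n], hf1 n⟩⟩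
    set w : H := E.starProjection (V fun n => (f n : ℂ)) with hw
    have hwE : T w = w := (hEmem w).1 (E.starProjection_apply_mem _)
    have hlim := Tc.tendsto_birkhoffAverage_orthogonalProjection hTn (V fun n => (f n : ℂ))
    let x : (ℕ → ℝ) → ℕ → ℝ := fun g n => (n : ℝ)⁻¹ * ∑ k ∈ Finset.range n, φ (fun i => f (i + k) * g i)
    have hfg : ∀ g, BdR g → ∀ k, BdR (fun i => f (i + k) * g i) := fun g ⟨C, hC⟩ k =>
      ⟨C, fun n => by
        rw [abs_mul, abs_of_nonneg (hf0 _)]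
        exact (mul_le_of_le_one_left (abs_nonneg _) (hf1 _)).trans (hC n)⟩
    have hx : ∀ g, BdR g → Tendsto (fun n => (x g n : ℂ)) atTop (𝓝 (inner ℂ w (V fun n => (g n : ℂ)))) := by
      intro g hg
      have := hlim.inner (𝕜 := ℂ) (tendsto_const_nhds (x := V fun n => (g n : ℂ)))
      refine this.congr fun n => ?_
      simp only [birkhoffAverage, birkhoffSum, id]
      rw [inner_smul_left, sum_inner]
      simp only [x]
      push_cast
      congr 1
      · simp
      · refine Finset.sum_congr rfl fun k _ => ?_
        rw [hiter _ (Bd.ofReal hfb), hV.inn _ _ ((Bd.ofReal hfb).comp (· + k)) (Bd.ofReal hg), ← hMφ _ (hfg g hg k)]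
        congr 1
        funext i
        simp
    have hre : ∀ g, BdR g → Tendsto (x g) atTop (𝓝 (inner ℂ w (V fun n => (g n : ℂ))).re) := by
      intro g hg
      have := (Complex.continuous_re.tendsto _).comp (hx g hg)
      exact this.congr fun n => by simp
    have him : ∀ g, BdR g → (inner ℂ w (V fun n => (g n : ℂ))).im = 0 := by
      intro g hg
      have := (Complex.continuous_im.tendsto _).comp (hx g hg)
      refine tendsto_nhds_unique this (tendsto_const_nhds.congr fun n => by simp)
    let ν : (ℕ → ℝ) → ℝ := fun g => if BdR g then (inner ℂ w (V fun n => (g n : ℂ))).re else 0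
    have hν : ∀ g, BdR g → ν g = (inner ℂ w (V fun n => (g n : ℂ))).re := fun g hg => if_pos hg
    have hν1 := hext ν (fun g hg => if_neg hg) (fun g h hg hh => by
        rw [hν _ hg, hν _ hh, hν _ (hg.add hh), ← Complex.add_re, ← inner_add_right, ← map_add]
        congr 4
        funext n; simp) (fun c g hg => by
        rw [hν _ hg, hν _ (hg.smul c)]
        have e : (fun n => (((c • g) n : ℝ) : ℂ)) = (c : ℂ) • fun n => (g n : ℂ) := by
          funext n; simp
        rw [e, map_smul, inner_smul_right]
        simp) (fun g hg h0 => by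
        rw [hν _ hg]
        refine ge_of_tendsto' (hre g hg) fun n => ?_
        refine mul_nonneg (by positivity) (Finset.sum_nonneg fun k _ => ?_)
        exact hφ.2.2.2.1 _ (hfg g hg k) (fun i => mul_nonneg (hf0 _) (h0 _))) (fun g hg h0 => by
        rw [hν _ hg]
        refine le_of_tendsto' (hre g hg) fun n => ?_
        have p := hφ.2.2.2.1 _ hg h0
        have : ∑ k ∈ Finset.range n, φ (fun i => f (i + k) * g i) ≤ n * φ g := by
          refine (Finset.sum_le_card_nsmul _ _ (φ g) fun k _ => ?_).trans (by simp)
          exact RMeans.le hφ (hfg g hg k) hg (fun i => mul_le_of_le_one_left (h0 _) (hf1 _))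
        rcases Nat.eq_zero_or_pos n with rfl | hn
        · simpa [x] using p
        · have hn' : (0 : ℝ) < n := by exact_mod_cast hn
          simp only [x]
          rw [inv_mul_le_iff₀ hn']
          exact this) (fun g hg => by
        rw [hν _ hg, hν _ hg.shift, ← hT _ (Bd.ofReal hg)]
        congr 1
        conv_lhs => rw [← hwE]
        rw [T.inner_map_map])
    have hreal : ∀ g, BdR g → inner ℂ w (V fun n => (g n : ℂ)) =
        inner ℂ (((ν fun _ => 1 : ℝ) : ℂ) • V fun _ => 1) (V fun n => (g n : ℂ)) := by
      intro g hg
      rw [inner_smul_left, ← hV.M_eq (Bd.ofReal hg), hMφ g hg]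
      apply Complex.ext
      · rw [← hν g hg, hν1 g hg]; simp
      · rw [him g hg]; simp
    have hall : ∀ g, Bd g → inner ℂ w (V g) =
        inner ℂ (((ν fun _ => 1 : ℝ) : ℂ) • V fun _ => 1) (V g) := by
      intro g hg
      have e1 : g = (fun n => ((g n).re : ℂ)) + Complex.I • fun n => ((g n).im : ℂ) := by
        funext n; apply Complex.ext <;> simp
      rw [e1, map_add, map_smul]
      simp only [inner_add_right, inner_smul_right, hreal _ hg.re, hreal _ hg.im]
    have : w = (((ν fun _ => 1 : ℝ) : ℂ) • V fun _ => 1) := by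
      refine ext_inner_right ℂ fun v => ?_
      refine hV.dense.induction (P := fun v => inner ℂ w v = inner ℂ (((ν fun _ => 1 : ℝ) : ℂ) • V fun _ => 1) v)
        ?_ (isClosed_eq (by fun_prop) (by fun_prop)) v
      rintro _ ⟨y, rfl⟩
      exact hall y.1 y.2
    rw [this]
    exact S.smul_mem _ (Submodule.mem_span_singleton_self _)
  have claim2 : ∀ f : ℕ → ℝ, BdR f → E.starProjection (V fun n => (f n : ℂ)) ∈ S := by
    intro f ⟨C, hC⟩
    have c1 := claim (fun n => (f n + (|C| + 1)) / (2 * (|C| + 1))) (fun n => by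
      have := abs_le.1 ((hC n).trans (le_abs_self C))
      have h0 := abs_nonneg C
      refine div_nonneg (by linarith) (by linarith)) (fun n => by
      have := abs_le.1 ((hC n).trans (le_abs_self C))
      have h0 := abs_nonneg C
      rw [div_le_one (by linarith)]; linarith)
    have c2 := claim (fun n => 1) (fun n => zero_le_one) (fun n => le_rfl)
    have e : (fun n => (f n : ℂ)) = ((2 * (|C| + 1) : ℝ) : ℂ) • (fun n => (((f n + (|C| + 1)) / (2 * (|C| + 1)) : ℝ) : ℂ))
        - ((|C| + 1 : ℝ) : ℂ) • fun n => ((1 : ℝ) : ℂ) := by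
      funext n
      simp only [Pi.sub_apply, Pi.smul_apply, smul_eq_mul]
      rw [← Complex.ofReal_mul, ← Complex.ofReal_mul, ← Complex.ofReal_sub]
      congr 1
      have h0 := abs_nonneg C
      field_simp
      ring
    rw [e, map_sub, map_smul, map_smul, map_sub, map_smul, map_smul]
    exact S.sub_mem (S.smul_mem _ c1) (S.smul_mem _ c2)
  have claim3 : ∀ v, E.starProjection v ∈ S := by
    intro v
    have hScl : IsClosed (S : Set H) := S.closed_of_finiteDimensional
    refine hV.dense.induction (P := fun v => E.starProjection v ∈ S)
        ?_ (hScl.preimage (E.starProjection).continuous) v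
    rintro _ ⟨y, rfl⟩
    have e1 : y.1 = (fun n => ((y.1 n).re : ℂ)) + Complex.I • fun n => ((y.1 n).im : ℂ) := by
      funext n; apply Complex.ext <;> simp
    simp only
    rw [e1, map_add, map_smul, map_add, map_smul]
    exact S.add_mem (claim2 _ (Bd.re y.2)) (S.smul_mem _ (claim2 _ (Bd.im y.2)))
  intro v hv
  have := claim3 v
  rw [Submodule.starProjection_eq_self_iff.2 ((hEmem v).2 hv)] at this
  obtain ⟨c, hc⟩ := Submodule.mem_span_singleton.1 this
  exact ⟨c, hc.symm⟩

lemma exists_sys (ℓ : ℕ) (hℓ : 0 < ℓ) (A : Set ℕ) (hA : 0 < upperBanachDensity A) :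
    ∃ (H : Type) (_ : NormedAddCommGroup H) (_ : InnerProductSpace ℂ H) (_ : CompleteSpace H)
      (M : (ℕ → ℂ) →ₗ[ℂ] ℂ) (V : (ℕ → ℂ) →ₗ[ℂ] H) (T : H ≃ₗᵢ[ℂ] H), IsSys M V T ∧
      0 < (M (fun N => ∑ k ∈ Finset.range ℓ, A.indicator (fun _ => (1 : ℂ)) (ℓ * N + k))).re := by
  obtain ⟨φ₀, hφ₀, h₀⟩ := exists_init ℓ hℓ A hA
  obtain ⟨φ, hφ, h1, hext⟩ := RMeans.exists_extreme hφ₀ h₀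
  obtain ⟨M, hM, hMφ⟩ := RMeans.exists_complex hφ
  obtain ⟨H, i1, i2, i3, V, hV⟩ := hM.exists_model
  obtain ⟨T, hT⟩ := hV.exists_shift
  refine ⟨H, i1, i2, i3, M, V, T, ⟨hV, hT, ?_⟩, ?_⟩
  swap
  · have hbd : BdR (fun N => ∑ k ∈ Finset.range ℓ, A.indicator (fun _ => (1 : ℝ)) (ℓ * N + k)) := by
      refine ⟨ℓ, fun n => ?_⟩
      refine (Finset.abs_sum_le_sum_abs _ _).trans
              ((Finset.sum_le_card_nsmul _ _ 1 fun k _ => ?_).trans ?_)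
      · by_cases h : (ℓ * n + k) ∈ A <;> simp [h]
      · simp
    have e : (fun N => ∑ k ∈ Finset.range ℓ, A.indicator (fun _ => (1 : ℂ)) (ℓ * N + k)) =
        fun N => ((∑ k ∈ Finset.range ℓ, A.indicator (fun _ => (1 : ℝ)) (ℓ * N + k) : ℝ) : ℂ) := by
      funext N
      push_cast
      refine Finset.sum_congr rfl fun k _ => ?_
      by_cases h : (ℓ * N + k) ∈ A <;> simp [h]
    rw [e, hMφ _ hbd]
    simpa using h1
  exact erg_of_extreme hφ hMφ hV hT hext

open Filter MeasureTheory Topology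
open scoped ComplexOrder ComplexConjugate

lemma hs_compact {H : Type} [NormedAddCommGroup H] [InnerProductSpace ℂ H] [CompleteSpace H]
    (K : H →L[ℂ] H) (C : ℝ) (hK : ∀ s : Finset H, Orthonormal ℂ ((↑) : s → H) →
      ∑ v ∈ s, ‖K v‖ ^ 2 ≤ C) : IsCompactOperator K := by
  classical
  have hcl : IsClosed {f : H →L[ℂ] H | IsCompactOperator f} := isClosed_setOfPred_isCompactOperator
  have : K ∈ closure {f : H →L[ℂ] H | IsCompactOperator f} := by
    rw [Metric.mem_closure_iff]
    intro ε hε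
    let X : Set ℝ := {x | ∃ s : Finset H, Orthonormal ℂ ((↑) : s → H) ∧ x = ∑ v ∈ s, ‖K v‖ ^ 2}
    have hXne : X.Nonempty := ⟨0, ∅, by
      refine ⟨fun i => ?_, fun i => ?_⟩ <;> exact absurd i.2 (Finset.notMem_empty _), by simp⟩
    have hXb : BddAbove X := ⟨C, by rintro _ ⟨s, hs, rfl⟩; exact hK s hs⟩
    obtain ⟨_, ⟨s, hs, rfl⟩, hlt⟩ := exists_lt_of_lt_csSup hXne
      (show sSup X - (ε / 2) ^ 2 < sSup X by have : 0 < (ε / 2) ^ 2 := by positivity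
                                             linarith)
    let F : Submodule ℂ H := Submodule.span ℂ (s : Set H)
    have : FiniteDimensional ℂ F := FiniteDimensional.span_finset ℂ s
    have hperp : ∀ y, y ∈ Fᗮ → ‖y‖ = 1 → ‖K y‖ ≤ ε / 2 := by
      intro y hy hy1
      have hys : ∀ v ∈ s, inner ℂ v y = 0 := fun v hv =>
        (Submodule.mem_orthogonal F y).1 hy v (Submodule.subset_span hv)
      have hyn : y ∉ s := fun h => by
        have := hys y h
        rw [inner_self_eq_zero] at this
        rw [this, norm_zero] at hy1
        exact zero_ne_one hy1
      have ho : Orthonormal ℂ (Subtype.val : ↥(insert y s : Finset H) → H) := by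
        have h0 := orthonormal_subtype_iff_ite.1 (show Orthonormal ℂ (Subtype.val : ↥(s : Set H) → H) from hs)
        have : Orthonormal ℂ (Subtype.val : ↥((insert y s : Finset H) : Set H) → H) := by
          rw [orthonormal_subtype_iff_ite]
          intro v hv w hw
          rw [Finset.mem_coe, Finset.mem_insert] at hv hw
          rcases hv with rfl | hv <;> rcases hw with rfl | hw
          · rw [inner_self_eq_norm_sq_to_K, hy1]; simp
          · rw [← inner_conj_symm, hys w hw, if_neg (by rintro rfl; exact hyn hw)]; simp
          · rw [hys v hv, if_neg (by rintro rfl; exact hyn hv)]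
          · exact h0 v hv w hw
        exact this
      have h1 : ∑ v ∈ insert y s, ‖K v‖ ^ 2 ≤ sSup X := le_csSup hXb ⟨_, ho, rfl⟩
      rw [Finset.sum_insert hyn] at h1
      refine le_of_sq_le_sq ?_ (by positivity)
      linarith
    have hperp2 : ∀ y ∈ Fᗮ, ‖K y‖ ≤ ε / 2 * ‖y‖ := by
      intro y hy
      by_cases h0 : y = 0
      · simp [h0]
      have hn : 0 < ‖y‖ := norm_pos_iff.2 h0
      have := hperp ((‖y‖⁻¹ : ℂ) • y) (Fᗮ.smul_mem _ hy) (by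
        rw [norm_smul]; simp [hn.ne'])
      rw [map_smul, norm_smul] at this
      simp only [norm_inv, Complex.norm_real, norm_norm] at this
      rwa [inv_mul_le_iff₀ hn, mul_comm] at this
    refine ⟨K ∘L F.starProjection, ?_, ?_⟩
    · have hc : IsCompactOperator (F.starProjection) := by
        have : ProperSpace F := FiniteDimensional.proper ℂ F
        have h1 : IsCompactOperator F.orthogonalProjectionOnto :=
          isCompactOperator_of_locallyCompactSpace_dom _
        have : IsCompactOperator (F.subtypeL ∘ F.orthogonalProjectionOnto) :=
          h1.clm_comp F.subtypeL
        exact this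
      exact hc.clm_comp K
    · rw [dist_eq_norm]
      refine lt_of_le_of_lt (ContinuousLinearMap.opNorm_le_bound _ (by positivity : 0 ≤ ε / 2) fun v => ?_)
        (by linarith)
      have e : (K - K ∘L F.starProjection) v = K (v - F.starProjection v) := by simp
      rw [e]
      refine (hperp2 _ (Submodule.sub_starProjection_mem_orthogonal v)).trans ?_
      refine mul_le_mul_of_nonneg_left ?_ (by positivity)
      have h2 : v - F.starProjection v = Fᗮ.starProjection v := by
        rw [Submodule.starProjection_orthogonal']; simp
      rw [h2]
      exact Fᗮ.norm_starProjection_apply_le v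
  rw [hcl.closure_eq] at this
  exact this

namespace IsSys
variable {H : Type} [NormedAddCommGroup H] [InnerProductSpace ℂ H] [CompleteSpace H]
  {M : (ℕ → ℂ) →ₗ[ℂ] ℂ} {V : (ℕ → ℂ) →ₗ[ℂ] H} {T : H ≃ₗᵢ[ℂ] H}

lemma eigen (hS : IsSys M V T) (z : Circle) (v : H) (hv : T v = (z : ℂ) • v) :
    ∃ c : ℂ, v = c • V (ch z) := by
  obtain ⟨U, hU⟩ := hS.toIsModel.exists_mulch z⁻¹
  have hc : ∀ w, T (U w) = ((z⁻¹ : Circle) : ℂ) • U (T w) := by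
    intro w
    refine hS.dense.induction (P := fun w => T (U w) = ((z⁻¹ : Circle) : ℂ) • U (T w)) ?_
      (isClosed_eq (by fun_prop) (by fun_prop)) w
    rintro _ ⟨⟨f, hf⟩, rfl⟩
    simp only
    rw [hU f hf, hS.T_V _ ((Bd.ch _).mul hf), hS.T_V f hf, hU _ (hf.comp (· + 1)), ← map_smul]
    congr 1
    funext n
    simp only [ch, Pi.smul_apply, smul_eq_mul, pow_succ]
    ring
  have hinv : T (U v) = U v := by
    rw [hc, hv, map_smul, smul_smul]
    simp
  obtain ⟨c, hc'⟩ := hS.erg _ hinv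
  refine ⟨c, U.injective ?_⟩
  rw [hc', map_smul, hU _ (Bd.ch z)]
  congr 2
  funext n
  simp only [ch, Circle.coe_inv, inv_pow]
  rw [inv_mul_cancel₀ (by simp)]

lemma shift_iter (hS : IsSys M V T) {f : ℕ → ℂ} (hf : Bd f) (k : ℕ) : M (fun n => f (n + k)) = M f := by
  induction k with
  | zero => rfl
  | succ k ih =>
    rw [← ih, ← hS.shift _ (hf.comp (· + k))]
    congr 1; funext n; congr 1; ring

lemma compactness (hS : IsSys M V T) (D : ℕ → H) (C : ℝ) (hD : ∀ n, ‖D n‖ ≤ C) (ℓ m : ℕ) (hm : 0 < m)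
    (hTD : ∀ n, T (D n) = D (n + ℓ))
    (horth : ∀ (z : Circle) (v : H), T v = (z : ℂ) • v → ∀ n, inner ℂ (D n) v = 0) (w : H) (t : ℕ) :
    V (fun b => inner ℂ (D (m * b + t)) w) = 0 := by
  classical
  have hb : ∀ (t : ℕ) (w : H) (b : ℕ), ‖inner ℂ (D (m * b + t)) w‖ ≤ C * ‖w‖ := fun t w b =>
    (norm_inner_le_norm _ _).trans (mul_le_mul_of_nonneg_right (hD _) (norm_nonneg _))
  have hbd : ∀ (w : H), Bd (fun n => inner ℂ (D n) w) := fun w => ⟨C * ‖w‖, fun b =>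
    (norm_inner_le_norm _ _).trans (mul_le_mul_of_nonneg_right (hD _) (norm_nonneg _))⟩
  have hBd : ∀ (t : ℕ) (w : H), Bd (fun b => inner ℂ (D (m * b + t)) w) := fun t w => ⟨_, hb t w⟩
  let K : ℕ → H →L[ℂ] H := fun t => LinearMap.mkContinuous
    { toFun := fun w => V (fun b => inner ℂ (D (m * b + t)) w)
      map_add' := fun w w' => by
        rw [← map_add]; congr 1; funext b; simp [inner_add_right]
      map_smul' := fun c w => by
        rw [← map_smul]; congr 1; funext b; simp [inner_smul_right] } C
      (fun w => hS.toIsModel.norm_V_le (hb t w))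
  have hKdef : ∀ t w, K t w = V (fun b => inner ℂ (D (m * b + t)) w) := fun _ _ => rfl
  have hKc : ∀ t, IsCompactOperator (K t) := by
    intro t
    refine hs_compact (K t) (C ^ 2) (fun s hs => ?_)
    have e : ((∑ v ∈ s, ‖K t v‖ ^ 2 : ℝ) : ℂ) = M (∑ v ∈ s, fun b => ((‖inner ℂ (D (m * b + t)) v‖ ^ 2 : ℝ) : ℂ)) := by
      rw [map_sum]
      push_cast
      refine Finset.sum_congr rfl fun v _ => ?_
      have := hS.toIsModel.norm_sq (hBd t v)
      push_cast at this
      exact this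
    have h2 := hS.toIsModel.mono (f := ∑ v ∈ s, fun b => ((‖inner ℂ (D (m * b + t)) v‖ ^ 2 : ℝ) : ℂ))
      (g := fun _ => ((C ^ 2 : ℝ) : ℂ)) (Bd.sum _ _ fun v _ => ⟨(C * ‖v‖) ^ 2, fun b => by
        simpa using pow_le_pow_left₀ (norm_nonneg _) (hb t v b) 2⟩) (Bd.const _) (fun b => by
        rw [Finset.sum_apply, ← Complex.ofReal_sum]
        have h3 := hs.sum_inner_products_le (D (m * b + t)) (s := Finset.univ)
        rw [Finset.sum_coe_sort s (fun v => ‖inner ℂ v (D (m * b + t))‖ ^ 2)] at h3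
        simp only [norm_inner_symm _ (D (m * b + t))] at h3
        exact_mod_cast h3.trans (pow_le_pow_left₀ (norm_nonneg _) (hD _) 2))
    rw [← e, hS.toIsModel.const] at h2
    exact_mod_cast h2
  let S : H →L[ℂ] H := ∑ t ∈ Finset.range m, (ContinuousLinearMap.adjoint (K t)) ∘L (K t)
  have hSin : ∀ w w', inner ℂ (S w) w' = ∑ t ∈ Finset.range m, inner ℂ (K t w) (K t w') := by
    intro w w'
    simp only [S, sum_apply, sum_inner, ContinuousLinearMap.comp_apply,
      ContinuousLinearMap.adjoint_inner_left]
  have hSc : IsCompactOperator S := by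
    have : ∀ s : Finset ℕ, IsCompactOperator (∑ t ∈ s, (ContinuousLinearMap.adjoint (K t)) ∘L (K t) : H →L[ℂ] H) := by
      intro s
      induction s using Finset.induction_on with
      | empty =>
        rw [Finset.sum_empty]
        exact (isCompactOperator_zero : IsCompactOperator (0 : H → H))
      | insert a s ha ih =>
        rw [Finset.sum_insert ha]
        exact ((hKc a).clm_comp (ContinuousLinearMap.adjoint (K a))).add ih
    exact this _
  have hSs : (S : H →ₗ[ℂ] H).IsSymmetric := by
    intro w w'
    change inner ℂ (S w) w' = inner ℂ w (S w')
    rw [hSin, ← inner_conj_symm, hSin, map_sum]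
    refine Finset.sum_congr rfl fun t _ => (inner_conj_symm _ _).symm
  -- invariance
  have hFinv : ∀ G : ℕ → ℂ, Bd G → ∑ t ∈ Finset.range m, M (fun b => G (m * b + t + 1)) =
      ∑ t ∈ Finset.range m, M (fun b => G (m * b + t)) := by
    intro G hG
    have h1 := Finset.sum_range_succ (fun t => M (fun b => G (m * b + t))) m
    rw [Finset.sum_range_succ'] at h1
    have h2 : M (fun b => G (m * b + m)) = M (fun b => G (m * b + 0)) := by
      rw [← hS.shift _ (hG.comp (fun b => m * b + 0))]
      congr 1
    rw [h2] at h1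
    exact add_right_cancel h1
  have hFinv' : ∀ G : ℕ → ℂ, Bd G → ∀ k, ∑ t ∈ Finset.range m, M (fun b => G (m * b + t + k)) =
      ∑ t ∈ Finset.range m, M (fun b => G (m * b + t)) := by
    intro G hG k
    induction k with
    | zero => rfl
    | succ k ih =>
      rw [← ih, ← hFinv (fun n => G (n + k)) (hG.comp (· + k))]
      refine Finset.sum_congr rfl fun t _ => ?_
      congr 1; funext b; congr 1; ring
  have hSin' : ∀ w w', inner ℂ (S w) w' = ∑ t ∈ Finset.range m,
      M (fun b => (fun n => conj (inner ℂ (D n) w) * inner ℂ (D n) w') (m * b + t)) := by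
    intro w w'
    rw [hSin]
    refine Finset.sum_congr rfl fun t _ => ?_
    rw [hKdef, hKdef, hS.inn _ _ (hBd t w) (hBd t w')]
  have hST : ∀ w, S (T w) = T (S w) := by
    intro w
    refine ext_inner_right ℂ fun v => ?_
    obtain ⟨w', rfl⟩ := T.surjective v
    rw [T.inner_map_map, hSin', hSin', ← hFinv' _ ((hbd (T w)).conj.mul (hbd (T w'))) ℓ]
    refine Finset.sum_congr rfl fun t _ => ?_
    congr 1; funext b
    simp only
    rw [← hTD, T.inner_map_map, T.inner_map_map]
  have hS0 : S = 0 := by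
    rw [← ContinuousLinearMap.eq_zero_of_forall_hasEigenvalue_eq_zero hSc hSs]
    intro μ hμ
    by_contra hne
    have := ContinuousLinearMap.finite_dimensional_eigenspace hSc μ hne
    have hmem : ∀ x ∈ Module.End.eigenspace (S : H →ₗ[ℂ] H) μ,
        (T.toLinearEquiv : H →ₗ[ℂ] H) x ∈ Module.End.eigenspace (S : H →ₗ[ℂ] H) μ := by
      intro x hx
      rw [Module.End.mem_eigenspace_iff] at hx ⊢
      change S (T x) = μ • T x
      rw [hST, show S x = μ • x from hx, map_smul]
    have : Nontrivial (Module.End.eigenspace (S : H →ₗ[ℂ] H) μ) :=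
      Submodule.nontrivial_iff_ne_bot.2 hμ
    obtain ⟨c, hc⟩ := Module.End.exists_eigenvalue ((T.toLinearEquiv : H →ₗ[ℂ] H).restrict hmem)
    obtain ⟨x, hx⟩ := hc.exists_hasEigenvector
    have hx1 : T x.1 = c • x.1 := congrArg Subtype.val hx.apply_eq_smul
    have hx0 : x.1 ≠ 0 := fun h => hx.2 (Subtype.ext h)
    have hc1 : ‖c‖ = 1 := by
      have := congrArg norm hx1
      rw [T.norm_map, norm_smul] at this
      have h0 := norm_pos_iff.2 hx0
      nlinarith
    have hor := horth ⟨c, mem_sphere_zero_iff_norm.2 hc1⟩ x.1 hx1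
    have hKx : ∀ t, K t x.1 = 0 := fun t => by
      rw [hKdef]; simp only [hor]
      exact map_zero V
    have hSx : S x.1 = 0 := by
      simp [S, hKx]
    have := Module.End.mem_eigenspace_iff.1 x.2
    rw [show (S : H →ₗ[ℂ] H) x.1 = 0 from hSx] at this
    rcases smul_eq_zero.1 this.symm with h | h
    · exact hne h
    · exact hx0 h
  have hK0 : ∀ t ∈ Finset.range m, ∀ w, K t w = 0 := by
    intro t ht w
    have h1 := hSin w w
    rw [hS0] at h1
    simp only [zero_apply, inner_zero_left, inner_self_eq_norm_sq_to_K] at h1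
    have h2 : (0 : ℝ) = ∑ t ∈ Finset.range m, ‖K t w‖ ^ 2 := by
      apply Complex.ofReal_injective
      push_cast
      exact h1
    have h3 := (Finset.sum_eq_zero_iff_of_nonneg (fun _ _ => by positivity)).1 h2.symm t ht
    simpa using h3
  have hall : ∀ q s, s < m → ∀ w, K (m * q + s) w = 0 := by
    intro q
    induction q with
    | zero => intro s hs w; rw [mul_zero, zero_add]; exact hK0 s (Finset.mem_range.2 hs) w
    | succ q ih =>
      intro s hs w
      have h1 := hS.T_V _ (hBd (m * q + s) w)
      have h2 := ih s hs w
      rw [hKdef] at h2 ⊢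
      rw [h2, map_zero] at h1
      rw [h1]
      congr 1; funext b; congr 2; ring
  have := hall (t / m) (t % m) (Nat.mod_lt _ hm) w
  rwa [Nat.div_add_mod, hKdef] at this

end IsSys

open Filter MeasureTheory Topology
open scoped ComplexOrder ComplexConjugate

/-- Trigonometric polynomials on `ℕ`. -/
def Trig : Submodule ℂ (ℕ → ℂ) := Submodule.span ℂ (Set.range ch)

/-- Functions with values in the unit interval. -/
def Box (f : ℕ → ℂ) : Prop := ∀ n, 0 ≤ f n ∧ f n ≤ 1

lemma Box.norm_le {f : ℕ → ℂ} (hf : Box f) (n : ℕ) : ‖f n‖ ≤ 1 := by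
  have h1 := Complex.le_def.1 (hf n).1
  have h2 := Complex.le_def.1 (hf n).2
  have e : f n = ((f n).re : ℂ) := Complex.ext (by simp) (by simpa using h1.2.symm)
  rw [e, Complex.norm_real, Real.norm_eq_abs, abs_le]
  simp only [Complex.zero_re, Complex.one_re] at h1 h2
  constructor <;> linarith

lemma Box.bd {f : ℕ → ℂ} (hf : Box f) : Bd f := ⟨1, hf.norm_le⟩

lemma Box.conj {f : ℕ → ℂ} (hf : Box f) (n : ℕ) : conj (f n) = f n :=
  Complex.conj_eq_iff_im.2 (Complex.le_def.1 (hf n).1).2.symm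

lemma ch_mem (z : Circle) : ch z ∈ Trig := Submodule.subset_span ⟨z, rfl⟩

lemma ch_mul (z w : Circle) : ch z * ch w = ch (z * w) := by
  funext n; simp [ch, mul_pow]

lemma ch_one : ch 1 = fun _ => 1 := by funext n; simp [ch]

lemma trig_const (c : ℂ) : (fun _ => c) ∈ Trig := by
  have := Trig.smul_mem c (ch_mem 1)
  rw [ch_one] at this
  convert this using 1
  funext n; simp

lemma trig_bd {f : ℕ → ℂ} (hf : f ∈ Trig) : Bd f := by
  have : Trig ≤ BSub := by
    refine Submodule.span_le.2 ?_
    rintro _ ⟨z, rfl⟩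
    exact Bd.ch z
  exact this hf

lemma trig_mul {f g : ℕ → ℂ} (hf : f ∈ Trig) (hg : g ∈ Trig) : f * g ∈ Trig := by
  have h1 : ∀ z, ch z * g ∈ Trig := by
    intro z
    have : Trig ≤ Trig.comap (LinearMap.mulLeft ℂ (ch z)) := by
      refine Submodule.span_le.2 ?_
      rintro _ ⟨w, rfl⟩
      change ch z * ch w ∈ Trig
      rw [ch_mul]; exact ch_mem _
    exact this hg
  have : Trig ≤ Trig.comap (LinearMap.mulRight ℂ g) := by
    refine Submodule.span_le.2 ?_
    rintro _ ⟨w, rfl⟩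
    exact h1 w
  exact this hf

lemma trig_conj {f : ℕ → ℂ} (hf : f ∈ Trig) : (fun n => conj (f n)) ∈ Trig := by
  refine Submodule.span_induction (p := fun f _ => (fun n => conj (f n)) ∈ Trig) ?_ ?_ ?_ ?_ hf
  · rintro _ ⟨z, rfl⟩
    have : (fun n => conj (ch z n)) = ch z⁻¹ := by
      funext n; simp only [ch, map_pow, Circle.coe_inv_eq_conj]
    rw [this]; exact ch_mem _
  · simpa using trig_const 0
  · intro x y _ _ hx hy
    have := Trig.add_mem hx hy
    convert this using 1
    funext n; simp
  · intro c x _ hx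
    have := Trig.smul_mem (conj c) hx
    convert this using 1
    funext n; simp

lemma ch_affine (z : Circle) (k j : ℕ) : (fun n => ch z (k * n + j)) = ch z j • ch (z ^ k) := by
  funext n; simp [ch, pow_add, pow_mul, mul_comm]

lemma trig_affine {f : ℕ → ℂ} (hf : f ∈ Trig) (k j : ℕ) : (fun n => f (k * n + j)) ∈ Trig := by
  have : Trig ≤ Trig.comap (LinearMap.funLeft ℂ ℂ (fun n => k * n + j)) := by
    refine Submodule.span_le.2 ?_
    rintro _ ⟨z, rfl⟩
    change (fun n => ch z (k * n + j)) ∈ Trig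
    rw [ch_affine]; exact Trig.smul_mem _ (ch_mem _)
  exact this hf

lemma trig_pow {f : ℕ → ℂ} (hf : f ∈ Trig) (k : ℕ) : f ^ k ∈ Trig := by
  induction k with
  | zero => exact trig_const 1
  | succ k ih => rw [pow_succ]; exact trig_mul ih hf

lemma trig_poly {s : ℕ → ℝ} (hs : (fun n => (s n : ℂ)) ∈ Trig) (P : Polynomial ℝ) :
    (fun n => ((P.eval (s n) : ℝ) : ℂ)) ∈ Trig := by
  induction P using Polynomial.induction_on' with
  | add p q hp hq =>
    have := Trig.add_mem hp hq
    convert this using 1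
    funext n; simp
  | monomial k c =>
    have := Trig.smul_mem (c : ℂ) (trig_pow hs k)
    convert this using 1
    funext n; simp

/-- indicator of a residue class -/
lemma trig_residue (ℓ : ℕ) (hℓ : 0 < ℓ) (k : ℕ) (hk : k < ℓ) :
    (fun n => if n % ℓ = k then (1 : ℂ) else 0) ∈ Trig := by
  have hζ := Complex.isPrimitiveRoot_exp ℓ hℓ.ne'
  set ζ0 := Complex.exp (2 * Real.pi * Complex.I / ℓ) with hζ0
  have hn : ‖ζ0‖ = 1 := hζ.norm'_eq_one hℓ.ne'
  let ζ : Circle := ⟨ζ0, mem_sphere_zero_iff_norm.2 hn⟩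
  have key : (fun n => if n % ℓ = k then (1 : ℂ) else 0) =
      fun n => ((ℓ : ℂ)⁻¹ • ∑ j ∈ Finset.range ℓ, ch (ζ ^ j)) (1 * n + (ℓ - k)) := by
    funext n
    simp only [Pi.smul_apply, Finset.sum_apply, ch, smul_eq_mul, one_mul]
    have e : ∀ j, (((ζ ^ j : Circle) : ℂ)) ^ (n + (ℓ - k)) = (ζ0 ^ (n + (ℓ - k))) ^ j := by
      intro j
      rw [Circle.coe_pow, ← pow_mul, ← pow_mul, mul_comm]
    simp only [e]
    have hdvd : n % ℓ = k ↔ ℓ ∣ n + (ℓ - k) := by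
      constructor
      · intro h
        have := Nat.div_add_mod n ℓ
        exact ⟨n / ℓ + 1, by rw [mul_add]; omega⟩
      · rintro ⟨c, hc⟩
        have hc0 : 0 < c := by
          rcases Nat.eq_zero_or_pos c with rfl | h
          · omega
          · exact h
        obtain ⟨c, rfl⟩ : ∃ d, c = d + 1 := ⟨c - 1, by omega⟩
        have : n = k + ℓ * c := by rw [mul_add] at hc; omega
        rw [this, Nat.add_mul_mod_self_left, Nat.mod_eq_of_lt hk]
    have hℓ' : (ℓ : ℂ) ≠ 0 := by exact_mod_cast hℓ.ne'
    by_cases h : n % ℓ = k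
    · rw [if_pos h, (hζ.pow_eq_one_iff_dvd _).2 (hdvd.1 h)]
      simp [hℓ']
    · rw [if_neg h]
      have h1 : ζ0 ^ (n + (ℓ - k)) ≠ 1 := fun h' => h (hdvd.2 ((hζ.pow_eq_one_iff_dvd _).1 h'))
      have h2 : (ζ0 ^ (n + (ℓ - k))) ^ ℓ = 1 := by
        rw [← pow_mul, mul_comm, pow_mul, hζ.pow_eq_one, one_pow]
      rw [geom_sum_eq h1, h2]
      simp
  rw [key]
  exact trig_affine (Trig.smul_mem _ (Trig.sum_mem fun j _ => ch_mem _)) 1 (ℓ - k)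

lemma trig_lift (ℓ : ℕ) (hℓ : 0 < ℓ) (k : ℕ) (hk : k < ℓ) {p : ℕ → ℂ} (hp : p ∈ Trig) :
    (fun n => if n % ℓ = k then p (n / ℓ) else 0) ∈ Trig := by
  refine Submodule.span_induction
    (p := fun p _ => (fun n => if n % ℓ = k then p (n / ℓ) else 0) ∈ Trig) ?_ ?_ ?_ ?_ hp
  · rintro _ ⟨z, rfl⟩
    obtain ⟨w, hw⟩ : ∃ w : Circle, w ^ ℓ = z := by
      refine ⟨Circle.exp (Complex.arg z / ℓ), ?_⟩
      rw [← Circle.exp_natCast_mul]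
      rw [mul_div_cancel₀ _ (by exact_mod_cast hℓ.ne' : (ℓ : ℝ) ≠ 0)]
      exact Circle.exp_arg z
    have := Trig.smul_mem ((w : ℂ) ^ k)⁻¹ (trig_mul (trig_residue ℓ hℓ k hk) (ch_mem w))
    convert this using 1
    funext n
    simp only [Pi.smul_apply, Pi.mul_apply, smul_eq_mul]
    by_cases h : n % ℓ = k
    · rw [if_pos h, if_pos h, one_mul]
      conv_rhs => rw [← Nat.div_add_mod n ℓ, h]
      have hw0 : (w : ℂ) ^ k ≠ 0 := by simp
      simp only [ch, ← hw, Circle.coe_pow, ← pow_mul, pow_add]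
      field_simp
    · rw [if_neg h, if_neg h]; simp
  · simpa using trig_const 0
  · intro x y _ _ hx hy
    have := Trig.add_mem hx hy
    convert this using 1
    funext n; simp only [Pi.add_apply]; split_ifs <;> simp
  · intro c x _ hx
    have := Trig.smul_mem c hx
    convert this using 1
    funext n; simp

lemma trig_glue (ℓ : ℕ) (hℓ : 0 < ℓ) (p : ℕ → ℕ → ℂ) (hp : ∀ k, p k ∈ Trig) :
    (fun n => p (n % ℓ) (n / ℓ)) ∈ Trig := by
  have := Trig.sum_mem (t := Finset.range ℓ) fun k hk =>
    trig_lift ℓ hℓ k (Finset.mem_range.1 hk) (hp k)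
  convert this using 1
  funext n
  rw [Finset.sum_apply]
  simp [Nat.mod_lt _ hℓ]

/-- Clamping to the unit interval, uniformly approximated by trigonometric polynomials. -/
lemma trig_clamp {s : ℕ → ℝ} (hs : (fun n => (s n : ℂ)) ∈ Trig) {ε : ℝ} (hε : 0 < ε) :
    ∃ p ∈ Trig, Box p ∧ ∀ n, ‖p n - (max 0 (min (s n) 1) : ℝ)‖ ≤ ε := by
  obtain ⟨C, hC⟩ := trig_bd hs
  have hη : 0 < ε / 4 := by positivity
  obtain ⟨P, hP⟩ := exists_polynomial_near_of_continuousOn (-C) C (fun x => max 0 (min x 1))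
    (by fun_prop) (ε / 4) hη
  have hP' : ∀ n, |P.eval (s n) - max 0 (min (s n) 1)| < ε / 4 := fun n => hP _ (by
    have := hC n
    rw [Complex.norm_real, Real.norm_eq_abs, abs_le] at this
    exact this)
  have hcl : ∀ n, 0 ≤ max 0 (min (s n) 1) ∧ max 0 (min (s n) 1) ≤ 1 := fun n =>
    ⟨le_max_left _ _, max_le zero_le_one (min_le_right _ _)⟩
  have hd : 0 < 1 + 2 * (ε / 4) := by positivity
  have hbox : ∀ n, 0 ≤ (P.eval (s n) + ε / 4) / (1 + 2 * (ε / 4)) ∧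
      (P.eval (s n) + ε / 4) / (1 + 2 * (ε / 4)) ≤ 1 := by
    intro n
    have h1 := abs_lt.1 (hP' n)
    have h2 := hcl n
    refine ⟨div_nonneg (by linarith) hd.le, (div_le_one hd).2 (by linarith)⟩
  refine ⟨fun n => (((Polynomial.C (1 + 2 * (ε / 4))⁻¹ * (P + Polynomial.C (ε / 4))).eval (s n) : ℝ) : ℂ),
    trig_poly hs _, fun n => ?_, fun n => ?_⟩
  · have := hbox n
    beta_reduce
    rw [Polynomial.eval_mul, Polynomial.eval_C, Polynomial.eval_add, Polynomial.eval_C, mul_comm,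
      ← div_eq_mul_inv]
    exact ⟨by exact_mod_cast this.1, by exact_mod_cast this.2⟩
  · beta_reduce
    rw [Polynomial.eval_mul, Polynomial.eval_C, Polynomial.eval_add, Polynomial.eval_C, mul_comm,
      ← div_eq_mul_inv, ← Complex.ofReal_sub, Complex.norm_real, Real.norm_eq_abs]
    have h1 := abs_lt.1 (hP' n)
    have h2 := hcl n
    rw [abs_le]
    constructor
    · rw [le_sub_iff_add_le, le_div_iff₀ hd]
      nlinarith [mul_nonneg hη.le h2.1, mul_le_mul_of_nonneg_left h2.2 hη.le, sq_nonneg ε]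
    · rw [sub_le_iff_le_add, div_le_iff₀ hd]
      nlinarith [mul_nonneg hη.le h2.1, sq_nonneg ε]

/-- Bohr neighbourhood property. -/
lemma trig_bohr {s : ℕ → ℂ} (hs : s ∈ Trig) : ∀ ε : ℝ, 0 < ε → ∃ (F : Finset Circle) (δ : ℝ), 0 < δ ∧
    ∀ u, (∀ z ∈ F, ‖ch z u - 1‖ < δ) → ‖s u - s 0‖ ≤ ε := by
  classical
  refine Submodule.span_induction (p := fun s _ => ∀ ε : ℝ, 0 < ε → ∃ (F : Finset Circle) (δ : ℝ), 0 < δ ∧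
    ∀ u, (∀ z ∈ F, ‖ch z u - 1‖ < δ) → ‖s u - s 0‖ ≤ ε) ?_ ?_ ?_ ?_ hs
  · rintro _ ⟨z, rfl⟩ ε hε
    refine ⟨{z}, ε, hε, fun u hu => ?_⟩
    have := hu z (by simp)
    simpa [ch] using this.le
  · intro ε hε
    exact ⟨∅, 1, one_pos, fun u _ => by simpa using hε.le⟩
  · intro x y _ _ hx hy ε hε
    obtain ⟨F, δ, hδ, h1⟩ := hx (ε / 2) (by positivity)
    obtain ⟨F', δ', hδ', h2⟩ := hy (ε / 2) (by positivity)
    refine ⟨F ∪ F', min δ δ', lt_min hδ hδ', fun u hu => ?_⟩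
    have a1 := h1 u fun z hz => (hu z (by simp [hz])).trans_le (min_le_left _ _)
    have a2 := h2 u fun z hz => (hu z (by simp [hz])).trans_le (min_le_right _ _)
    have e : (x + y) u - (x + y) 0 = (x u - x 0) + (y u - y 0) := by simp; ring
    rw [e]
    exact (norm_add_le _ _).trans (by linarith)
  · intro c x _ hx ε hε
    obtain ⟨F, δ, hδ, h1⟩ := hx (ε / (‖c‖ + 1)) (by positivity)
    refine ⟨F, δ, hδ, fun u hu => ?_⟩
    have a1 := h1 u hu
    have e : (c • x) u - (c • x) 0 = c * (x u - x 0) := by simp; ring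
    rw [e, norm_mul]
    rw [le_div_iff₀ (by positivity)] at a1
    nlinarith [norm_nonneg c, norm_nonneg (x u - x 0)]

namespace IsSys
variable {H : Type} [NormedAddCommGroup H] [InnerProductSpace ℂ H] [CompleteSpace H]
  {M : (ℕ → ℂ) →ₗ[ℂ] ℂ} {V : (ℕ → ℂ) →ₗ[ℂ] H} {T : H ≃ₗᵢ[ℂ] H}

open scoped Classical in
lemma M_ch (hS : IsSys M V T) (z : Circle) : M (ch z) = if z = 1 then 1 else 0 := by
  split_ifs with h
  · rw [h, ch_one, hS.one]
  · have h1 := hS.shift _ (Bd.ch z)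
    have e : (fun n => ch z (n + 1)) = (z : ℂ) • ch z := by
      funext n; simp [ch, pow_succ, mul_comm]
    rw [e, map_smul, smul_eq_mul] at h1
    have h2 : ((z : ℂ) - 1) * M (ch z) = 0 := by rw [sub_mul, h1, one_mul, sub_self]
    rcases mul_eq_zero.1 h2 with h3 | h3
    · exact absurd (Circle.ext (by simpa using sub_eq_zero.1 h3)) h
    · exact h3

lemma dilation (hS : IsSys M V T) {s : ℕ → ℂ} (hs : s ∈ Trig) (k : ℕ) (hk : 0 < k) (i : ℕ) :
    ∑ j ∈ Finset.range k, M (fun n => s (k * n + (i + j))) = k * M s := by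
  refine Submodule.span_induction
    (p := fun s _ => ∑ j ∈ Finset.range k, M (fun n => s (k * n + (i + j))) = k * M s) ?_ ?_ ?_ ?_ hs
  · rintro _ ⟨z, rfl⟩
    simp only [ch_affine, map_smul, hS.M_ch, smul_eq_mul]
    rw [← Finset.sum_mul]
    by_cases h : z = 1
    · simp [h, ch]
    · rw [if_neg h, mul_zero]
      by_cases h2 : z ^ k = 1
      · have h3 : (z : ℂ) ≠ 1 := fun h' => h (Circle.ext (by simpa using h'))
        have h4 : (z : ℂ) ^ k = 1 := by rw [← Circle.coe_pow, h2]; simp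
        simp only [ch, pow_add]
        rw [← Finset.mul_sum, geom_sum_eq h3, h4]
        simp
      · simp [h2]
  · simp only [Pi.zero_apply]
    have : M (fun _ => 0) = 0 := map_zero M
    simp [this]
  · intro x y _ _ hx hy
    rw [map_add, mul_add, ← hx, ← hy, ← Finset.sum_add_distrib]
    refine Finset.sum_congr rfl fun j _ => ?_
    rw [← map_add]; rfl
  · intro c x _ hx
    rw [map_smul, smul_eq_mul, mul_left_comm, ← hx, Finset.mul_sum]
    refine Finset.sum_congr rfl fun j _ => ?_
    rw [← smul_eq_mul, ← map_smul]; rfl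

lemma recurrence (hS : IsSys M V T) (F : Finset Circle) (δ : ℝ) (hδ : 0 < δ) :
    ∃ R : Set ℕ, 0 < (M (R.indicator fun _ => 1)).re ∧ ∀ u ∈ R, ∀ z ∈ F, ‖ch z u - 1‖ < δ := by
  classical
  have hind : ∀ R : Set ℕ, Bd (R.indicator fun _ => 1) := fun R =>
    ⟨1, fun n => by by_cases h : n ∈ R <;> simp [h]⟩
  let g : ℕ → (F → Circle) := fun u z => z.1 ^ u
  obtain ⟨t, htf, htc⟩ := Metric.totallyBounded_iff.1 (isCompact_univ (X := F → Circle)).totallyBounded (δ / 2) (by positivity)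
  let t' : Finset (F → Circle) := htf.toFinset
  let Cc : (F → Circle) → Set ℕ := fun x => {u | dist (g u) x < δ / 2}
  have hpos : ∃ x ∈ t', 0 < (M ((Cc x).indicator fun _ => 1)).re := by
    by_contra hno
    push Not at hno
    have h1 := hS.toIsModel.mono (f := fun _ => 1) (g := ∑ x ∈ t', (Cc x).indicator fun _ => 1) (Bd.const 1)
      (Bd.sum _ _ fun x _ => hind _) (fun u => by
        obtain ⟨x, hx, hux⟩ := Set.mem_iUnion₂.1 (htc (Set.mem_univ (g u)))
        rw [Finset.sum_apply]
        have := Finset.single_le_sum (f := fun x => (Cc x).indicator (fun _ => (1 : ℂ)) u)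
          (fun i _ => Set.indicator_nonneg (fun _ _ => zero_le_one) _) (htf.mem_toFinset.2 hx)
        refine le_trans ?_ this
        rw [Set.indicator_of_mem]
        exact hux)
    rw [hS.one, map_sum] at h1
    have h2 := (Complex.le_def.1 h1).1
    rw [Complex.re_sum] at h2
    have := Finset.sum_nonpos fun x hx => hno x hx
    simp only [Complex.one_re] at h2
    linarith
  obtain ⟨x, -, hx⟩ := hpos
  have hne : (Cc x).Nonempty := by
    by_contra h
    rw [Set.not_nonempty_iff_eq_empty] at h
    rw [h, Set.indicator_empty] at hx
    have : M (fun _ => 0) = 0 := map_zero M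
    rw [this] at hx
    simp at hx
  have hu0 := Nat.sInf_mem hne
  set u0 := sInf (Cc x) with hu0d
  refine ⟨{u | u + u0 ∈ Cc x}, ?_, ?_⟩
  · have := hS.shift_iter (hind (Cc x)) u0
    rw [← this] at hx
    exact hx
  · intro u hu z hz
    have h1 : dist (g (u + u0)) (g u0) < δ := by
      have a1 : dist (g (u + u0)) x < δ / 2 := hu
      have a2 : dist (g u0) x < δ / 2 := hu0
      rw [dist_comm] at a2
      exact (dist_triangle _ x _).trans_lt (by linarith)
    have h2 := (dist_le_pi_dist (g (u + u0)) (g u0) ⟨z, hz⟩).trans_lt h1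
    have h3 : dist (g (u + u0) ⟨z, hz⟩) (g u0 ⟨z, hz⟩) = ‖ch z (u + u0) - ch z u0‖ := by
      change dist ((z ^ (u + u0) : Circle) : ℂ) ((z ^ u0 : Circle) : ℂ) = _
      rw [dist_eq_norm, Circle.coe_pow, Circle.coe_pow]
      rfl
    rw [h3] at h2
    have e : ch z (u + u0) - ch z u0 = (ch z u - 1) * ch z u0 := by
      simp only [ch, pow_add]; ring
    rwa [e, norm_mul, norm_ch, mul_one] at h2

/-- A uniform limit of trigonometric polynomials with zero norm vanishes at zero. -/
lemma ap_zero (hS : IsSys M V T) {Y : ℕ → ℂ} (hY : ∀ ε : ℝ, 0 < ε → ∃ s ∈ Trig, ∀ u, ‖Y u - s u‖ ≤ ε)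
    (h0 : V Y = 0) : Y 0 = 0 := by
  by_contra hne
  have hp : 0 < ‖Y 0‖ := norm_pos_iff.2 hne
  obtain ⟨s, hs, hYs⟩ := hY (‖Y 0‖ / 8) (by positivity)
  obtain ⟨F, δ, hδ, hF⟩ := trig_bohr hs (‖Y 0‖ / 8) (by positivity)
  obtain ⟨R, hR, hRF⟩ := hS.recurrence F δ hδ
  have hYb : Bd Y := by
    obtain ⟨C, hC⟩ := trig_bd hs
    refine ⟨‖Y 0‖ / 8 + C, fun n => ?_⟩
    have := norm_add_le (Y n - s n) (s n)
    rw [sub_add_cancel] at this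
    linarith [hYs n, hC n]
  have h1 := hS.norm_V_mono (f := ((‖Y 0‖ / 2 : ℝ) : ℂ) • R.indicator fun _ => 1) (g := Y)
    (Bd.smul _ ⟨1, fun n => by by_cases h : n ∈ R <;> simp [h]⟩) hYb (fun u => by
      by_cases h : u ∈ R
      · simp only [Pi.smul_apply, Set.indicator_of_mem h, smul_eq_mul, mul_one, Complex.norm_real]
        rw [Real.norm_of_nonneg (by positivity)]
        have a1 := hF u (hRF u h)
        have a2 := hYs u
        have a3 := hYs 0
        have e : Y 0 = Y u - (Y u - s u) - (s u - s 0) + (Y 0 - s 0) := by ring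
        have := (norm_add_le (Y u - (Y u - s u) - (s u - s 0)) (Y 0 - s 0)).trans
          (add_le_add_left ((norm_sub_le (Y u - (Y u - s u)) (s u - s 0)).trans
            (add_le_add_left (norm_sub_le _ _) _)) _)
        rw [← e] at this
        linarith
      · simp [h])
  rw [h0, norm_zero] at h1
  have h2 := hS.norm_M_le_V (f := ((‖Y 0‖ / 2 : ℝ) : ℂ) • R.indicator fun _ => 1)
    (Bd.smul _ ⟨1, fun n => by by_cases h : n ∈ R <;> simp [h]⟩)
  have h3 : M (((‖Y 0‖ / 2 : ℝ) : ℂ) • R.indicator fun _ => 1) = 0 :=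
    norm_le_zero_iff.1 (h2.trans h1)
  rw [map_smul, smul_eq_mul] at h3
  rcases mul_eq_zero.1 h3 with h4 | h4
  · have : ‖Y 0‖ / 2 = 0 := by exact_mod_cast h4
    linarith
  · rw [h4] at hR; simp at hR

end IsSys

open Filter MeasureTheory Topology
open scoped ComplexOrder ComplexConjugate

namespace IsSys
variable {H : Type} [NormedAddCommGroup H] [InnerProductSpace ℂ H] [CompleteSpace H]
  {M : (ℕ → ℂ) →ₗ[ℂ] ℂ} {V : (ℕ → ℂ) →ₗ[ℂ] H} {T : H ≃ₗᵢ[ℂ] H}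

lemma M_add (M : (ℕ → ℂ) →ₗ[ℂ] ℂ) (f g : ℕ → ℂ) : M (fun n => f n + g n) = M f + M g :=
  map_add M f g

lemma M_cmul (M : (ℕ → ℂ) →ₗ[ℂ] ℂ) (c : ℂ) (f : ℕ → ℂ) : M (fun n => c * f n) = c * M f :=
  map_smul M c f

lemma M_zero (M : (ℕ → ℂ) →ₗ[ℂ] ℂ) : M (fun _ => 0) = 0 := map_zero M

lemma trig_M (M : (ℕ → ℂ) →ₗ[ℂ] ℂ) (f : ℕ → ℂ) {s2 s3 : ℕ → ℂ} (h2 : s2 ∈ Trig) (h3 : s3 ∈ Trig) (k m t : ℕ) :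
    (fun u => M (fun N => f N * s2 (N + u) * s3 (k * N + m * u + t))) ∈ Trig := by
  refine Submodule.span_induction (p := fun s2 _ =>
    (fun u => M (fun N => f N * s2 (N + u) * s3 (k * N + m * u + t))) ∈ Trig) ?_ ?_ ?_ ?_ h2
  · rintro _ ⟨z, rfl⟩
    refine Submodule.span_induction (p := fun s3 _ =>
      (fun u => M (fun N => f N * ch z (N + u) * s3 (k * N + m * u + t))) ∈ Trig) ?_ ?_ ?_ ?_ h3
    · rintro _ ⟨w, rfl⟩
      have := Trig.smul_mem (M (fun N => f N * ch z N * ch w (k * N + t))) (trig_mul (ch_mem z) (ch_mem (w ^ m)))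
      convert this using 1
      funext u
      simp only [Pi.smul_apply, Pi.mul_apply, smul_eq_mul]
      rw [mul_comm (M _), ← M_cmul]
      congr 1
      funext N
      simp only [ch, Circle.coe_pow, pow_add, ← pow_mul]
      ring
    · simp only [Pi.zero_apply, mul_zero, M_zero]
      exact trig_const 0
    · intro x y _ _ hx hy
      have := Trig.add_mem hx hy
      convert this using 1
      funext u
      simp only [Pi.add_apply, mul_add, M_add]
    · intro c x _ hx
      have := Trig.smul_mem c hx
      convert this using 1
      funext u
      simp only [Pi.smul_apply, smul_eq_mul, mul_left_comm _ c, M_cmul]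
  · simp only [Pi.zero_apply, mul_zero, zero_mul, M_zero]
    exact trig_const 0
  · intro x y _ _ hx hy
    have := Trig.add_mem hx hy
    convert this using 1
    funext u
    simp only [Pi.add_apply, mul_add, add_mul, M_add]
  · intro c x _ hx
    have := Trig.smul_mem c hx
    convert this using 1
    funext u
    simp only [Pi.smul_apply, smul_eq_mul, mul_left_comm _ c, mul_assoc, M_cmul]

lemma two_var (hS : IsSys M V T) {s1 s2 s3 : ℕ → ℂ} (h1 : s1 ∈ Trig) (h2 : s2 ∈ Trig) (h3 : s3 ∈ Trig)
    (ℓ m t : ℕ) :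
    M (fun b => M (fun N => s1 b * s2 N * s3 (ℓ * N + m * b + t))) =
      M (fun u => M (fun N => s1 (N + u) * s2 N * s3 ((ℓ + m) * N + m * u + t))) := by
  classical
  refine Submodule.span_induction (p := fun s1 _ =>
    M (fun b => M (fun N => s1 b * s2 N * s3 (ℓ * N + m * b + t))) =
      M (fun u => M (fun N => s1 (N + u) * s2 N * s3 ((ℓ + m) * N + m * u + t)))) ?_ ?_ ?_ ?_ h1
  · rintro _ ⟨z1, rfl⟩
    refine Submodule.span_induction (p := fun s2 _ =>
      M (fun b => M (fun N => ch z1 b * s2 N * s3 (ℓ * N + m * b + t))) =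
        M (fun u => M (fun N => ch z1 (N + u) * s2 N * s3 ((ℓ + m) * N + m * u + t)))) ?_ ?_ ?_ ?_ h2
    · rintro _ ⟨z2, rfl⟩
      refine Submodule.span_induction (p := fun s3 _ =>
        M (fun b => M (fun N => ch z1 b * ch z2 N * s3 (ℓ * N + m * b + t))) =
          M (fun u => M (fun N => ch z1 (N + u) * ch z2 N * s3 ((ℓ + m) * N + m * u + t)))) ?_ ?_ ?_ ?_ h3
      · rintro _ ⟨z3, rfl⟩
        have e1 : ∀ b N, ch z1 b * ch z2 N * ch z3 (ℓ * N + m * b + t) =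
            (ch z3 t * ch (z1 * z3 ^ m) b) * ch (z2 * z3 ^ ℓ) N := by
          intro b N
          simp only [ch, Circle.coe_mul, Circle.coe_pow, pow_add, mul_pow, ← pow_mul]
          ring
        have e2 : ∀ u N, ch z1 (N + u) * ch z2 N * ch z3 ((ℓ + m) * N + m * u + t) =
            (ch z3 t * ch (z1 * z3 ^ m) u) * ch ((z1 * z3 ^ m) * (z2 * z3 ^ ℓ)) N := by
          intro b N
          simp only [ch, Circle.coe_mul, Circle.coe_pow, pow_add, mul_pow, ← pow_mul, add_mul]
          ring
        have e3 : ∀ (y : Circle) (c d : ℂ), M (fun b => c * ch y b * d) = c * d * M (ch y) := by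
          intro y c d
          rw [← M_cmul]
          congr 1
          funext b
          ring
        simp only [e1, e2, M_cmul, e3]
        by_cases h : z1 * z3 ^ m = 1
        · simp [h]
        · rw [hS.M_ch (z1 * z3 ^ m), if_neg h]; simp
      · simp only [Pi.zero_apply, mul_zero, M_zero]
      · intro x y _ _ hx hy
        simp only [Pi.add_apply, mul_add, M_add, hx, hy]
      · intro c x _ hx
        simp only [Pi.smul_apply, smul_eq_mul, mul_left_comm _ c, M_cmul, hx]
    · simp only [Pi.zero_apply, mul_zero, zero_mul, M_zero]
    · intro x y _ _ hx hy
      simp only [Pi.add_apply, mul_add, add_mul, M_add, hx, hy]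
    · intro c x _ hx
      simp only [mul_assoc, M_cmul] at hx
      simp only [Pi.smul_apply, smul_eq_mul, mul_left_comm _ c, mul_assoc, M_cmul, hx]
  · simp only [Pi.zero_apply, mul_zero, zero_mul, M_zero]
  · intro x y _ _ hx hy
    simp only [Pi.add_apply, mul_add, add_mul, M_add, hx, hy]
  · intro c x _ hx
    simp only [mul_assoc, M_cmul] at hx
    simp only [Pi.smul_apply, smul_eq_mul, mul_left_comm _ c, mul_assoc, M_cmul, hx]

lemma dil_sq (hS : IsSys M V T) {s : ℕ → ℂ} (hs : s ∈ Trig) (k : ℕ) (hk : 0 < k) (i : ℕ) :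
    ∑ j ∈ Finset.range k, ‖V (fun n => s (k * n + (i + j)))‖ ^ 2 = k * ‖V s‖ ^ 2 := by
  have h1 : (fun n => ((‖s n‖ ^ 2 : ℝ) : ℂ)) ∈ Trig := by
    have := trig_mul (trig_conj hs) hs
    convert this using 1
    funext n
    simp [Complex.conj_mul']
  have h2 := hS.dilation h1 k hk i
  rw [← hS.norm_sq (trig_bd hs)] at h2
  have h3 : ∀ j, M (fun n => ((‖s (k * n + (i + j))‖ ^ 2 : ℝ) : ℂ)) =
      ((‖V (fun n => s (k * n + (i + j)))‖ ^ 2 : ℝ) : ℂ) := fun j =>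
    (hS.norm_sq (trig_bd (trig_affine hs k (i + j)))).symm
  simp only [h3] at h2
  exact_mod_cast h2

lemma norm_shift (hS : IsSys M V T) {s : ℕ → ℂ} (hs : s ∈ Trig) (u : ℕ) :
    ‖V (fun n => s (n + u))‖ = ‖V s‖ := by
  have := hS.dil_sq hs 1 one_pos u
  simp only [Finset.range_one, Finset.sum_singleton, one_mul, add_zero, Nat.cast_one] at this
  exact (sq_eq_sq₀ (norm_nonneg _) (norm_nonneg _)).1 this

lemma norm_of_dil (hS : IsSys M V T) {s : ℕ → ℂ} (hs : s ∈ Trig) (ℓ : ℕ) (hℓ : 0 < ℓ) (ε : ℝ) 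
    (h : ∀ n, ‖V (fun N => s (ℓ * N + n))‖ ≤ ε) (r n : ℕ) (hr : 0 < r) : ‖V (fun N => s (r * N + n))‖ ≤ r * ε := by
  have hε : 0 ≤ ε := (norm_nonneg _).trans (h 0)
  have hℓ' : (0 : ℝ) < ℓ := by exact_mod_cast hℓ
  have h1 : ‖V s‖ ≤ ε := by
    have := hS.dil_sq hs ℓ hℓ 0
    have h2 : ∑ j ∈ Finset.range ℓ, ‖V (fun n => s (ℓ * n + (0 + j)))‖ ^ 2 ≤ ∑ j ∈ Finset.range ℓ, ε ^ 2 :=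
      Finset.sum_le_sum fun j _ => pow_le_pow_left₀ (norm_nonneg _) (h _) 2
    rw [this, Finset.sum_const, Finset.card_range, nsmul_eq_mul] at h2
    exact (sq_le_sq₀ (norm_nonneg _) hε).1 (le_of_mul_le_mul_left h2 hℓ')
  have h3 := hS.dil_sq hs r hr n
  have h4 := Finset.single_le_sum (f := fun j => ‖V (fun N => s (r * N + (n + j)))‖ ^ 2) (fun i _ => by positivity)
    (Finset.mem_range.2 hr)
  rw [h3] at h4
  simp only [add_zero] at h4
  have hr1 : (1 : ℝ) ≤ r := by exact_mod_cast hr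
  refine (sq_le_sq₀ (norm_nonneg _) (by positivity)).1 (h4.trans ?_)
  have : ‖V s‖ ^ 2 ≤ ε ^ 2 := pow_le_pow_left₀ (norm_nonneg _) h1 2
  nlinarith [mul_le_mul_of_nonneg_left this (by positivity : (0 : ℝ) ≤ r), mul_nonneg (mul_nonneg (by linarith : (0 : ℝ) ≤ r) (by linarith : (0 : ℝ) ≤ r - 1)) (sq_nonneg ε)]

end IsSys

/-- Closure of the trigonometric polynomials. -/
def TW {H : Type} [NormedAddCommGroup H] [InnerProductSpace ℂ H] (V : (ℕ → ℂ) →ₗ[ℂ] H) : Submodule ℂ H :=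
  (Trig.map V).topologicalClosure

instance {H : Type} [NormedAddCommGroup H] [InnerProductSpace ℂ H] [CompleteSpace H] (V : (ℕ → ℂ) →ₗ[ℂ] H) :
    CompleteSpace (TW V) := (Submodule.isClosed_topologicalClosure _).completeSpace_coe

/-- Projection. -/
noncomputable def PW {H : Type} [NormedAddCommGroup H] [InnerProductSpace ℂ H] [CompleteSpace H]
    (V : (ℕ → ℂ) →ₗ[ℂ] H) : H →L[ℂ] H := (TW V).starProjection

section
variable {H : Type} [NormedAddCommGroup H] [InnerProductSpace ℂ H] {V : (ℕ → ℂ) →ₗ[ℂ] H}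

lemma V_mem {s : ℕ → ℂ} (hs : s ∈ Trig) : V s ∈ TW V :=
  Submodule.le_topologicalClosure _ (Submodule.mem_map_of_mem hs)

lemma TW_approx {w : H} (hw : w ∈ TW V) {ε : ℝ} (hε : 0 < ε) : ∃ s ∈ Trig, ‖V s - w‖ ≤ ε := by
  have h : w ∈ closure ((Trig.map V : Submodule ℂ H) : Set H) := hw
  obtain ⟨_, ⟨s, hs, rfl⟩, hd⟩ := Metric.mem_closure_iff.1 h ε hε
  refine ⟨s, hs, ?_⟩
  rw [dist_comm, dist_eq_norm] at hd
  exact hd.le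

lemma TW_of_approx {w : H} (h : ∀ ε : ℝ, 0 < ε → ∃ v ∈ TW V, ‖v - w‖ ≤ ε) : w ∈ TW V := by
  have hc : IsClosed (TW V : Set H) := Submodule.isClosed_topologicalClosure _
  have : w ∈ closure (TW V : Set H) := by
    refine Metric.mem_closure_iff.2 fun ε hε => ?_
    obtain ⟨v, hv, hd⟩ := h (ε / 2) (by positivity)
    refine ⟨v, hv, ?_⟩
    rw [dist_comm, dist_eq_norm]
    linarith
  rwa [hc.closure_eq] at this

lemma TW_induct {K : Submodule ℂ H} (hK : IsClosed (K : Set H)) (h : ∀ z, V (ch z) ∈ K) : TW V ≤ K := by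
  refine Submodule.topologicalClosure_minimal _ ?_ hK
  rw [Trig, Submodule.map_span_le]
  rintro _ ⟨z, rfl⟩
  exact h z

lemma mem_orth {v : H} (h : ∀ z, inner ℂ (V (ch z)) v = 0) : v ∈ (TW V)ᗮ := by
  have h1 : TW V ≤ (ℂ ∙ v)ᗮ := TW_induct (Submodule.isClosed_orthogonal _) fun z => by
    rw [Submodule.mem_orthogonal_singleton_iff_inner_left]
    exact h z
  rw [Submodule.mem_orthogonal]
  intro u hu
  exact (Submodule.mem_orthogonal_singleton_iff_inner_left).1 (h1 hu)

variable [CompleteSpace H]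

lemma PW_mem (v : H) : PW V v ∈ TW V := Submodule.starProjection_apply_mem _ _

lemma PW_inner (v : H) {w : H} (hw : w ∈ TW V) : inner ℂ w (PW V v) = inner ℂ w v := by
  have : inner ℂ w (v - PW V v) = 0 := Submodule.inner_right_of_mem_orthogonal hw
    (Submodule.sub_starProjection_mem_orthogonal v)
  rw [inner_sub_right, sub_eq_zero] at this
  exact this.symm

lemma PW_inner' (v : H) {w : H} (hw : w ∈ TW V) : inner ℂ (PW V v) w = inner ℂ v w := by
  rw [← inner_conj_symm, PW_inner v hw, inner_conj_symm]

lemma PW_norm (v : H) : ‖PW V v‖ ≤ ‖v‖ := Submodule.norm_starProjection_apply_le _ _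

lemma PW_eq {u v : H} (hv : v ∈ TW V) (h : ∀ z, inner ℂ (V (ch z)) (u - v) = 0) : PW V u = v :=
  Submodule.eq_starProjection_of_mem_orthogonal hv (mem_orth h)

lemma PW_comm (U : H ≃ₗᵢ[ℂ] H) (h1 : ∀ w, U (V (ch w)) ∈ TW V) (h2 : ∀ w, ∃ v ∈ TW V, U v = V (ch w)) (x : H) :
    PW V (U x) = U (PW V x) := by
  refine PW_eq ?_ fun z => ?_
  · have : TW V ≤ (TW V).comap U.toLinearEquiv.toLinearMap := TW_induct
      ((Submodule.isClosed_topologicalClosure _).preimage U.continuous) h1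
    exact this (PW_mem x)
  · obtain ⟨v, hv, hvz⟩ := h2 z
    rw [← hvz, ← map_sub, LinearIsometryEquiv.inner_map_map, inner_sub_right, PW_inner _ hv, sub_self]

end

open Filter MeasureTheory Topology
open scoped ComplexOrder ComplexConjugate

namespace IsSys
variable {H : Type} [NormedAddCommGroup H] [InnerProductSpace ℂ H] [CompleteSpace H]
  {M : (ℕ → ℂ) →ₗ[ℂ] ℂ} {V : (ℕ → ℂ) →ₗ[ℂ] H} {T : H ≃ₗᵢ[ℂ] H}

lemma PW_T (hS : IsSys M V T) (x : H) : PW V (T x) = T (PW V x) := by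
  have h : ∀ w, T (V (ch w)) = (w : ℂ) • V (ch w) := fun w => by
    rw [hS.T_V _ (Bd.ch w), ← map_smul]
    congr 1
    funext n; simp [ch, pow_succ, mul_comm]
  refine PW_comm T (fun w => ?_) (fun w => ⟨((w : ℂ))⁻¹ • V (ch w), ?_, ?_⟩) x
  · rw [h]; exact Submodule.smul_mem _ _ (V_mem (ch_mem w))
  · exact Submodule.smul_mem _ _ (V_mem (ch_mem w))
  · rw [map_smul, h, inv_smul_smul₀ (Circle.coe_ne_zero w)]

lemma PW_U (hS : IsSys M V T) (z : Circle) (U : H ≃ₗᵢ[ℂ] H) (hU : ∀ f, Bd f → U (V f) = V (fun n => ch z n * f n))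
    (x : H) : PW V (U x) = U (PW V x) := by
  have h : ∀ w, U (V (ch w)) = V (ch (z * w)) := fun w => by
    rw [hU _ (Bd.ch w), ← ch_mul]; rfl
  refine PW_comm U (fun w => ?_) (fun w => ⟨V (ch (z⁻¹ * w)), ?_, ?_⟩) x
  · rw [h]; exact V_mem (ch_mem _)
  · exact V_mem (ch_mem _)
  · rw [h, mul_inv_cancel_left]

lemma box_approx (hS : IsSys M V T) {f : H} (hf : ∀ ε : ℝ, 0 < ε → ∃ g, Box g ∧ ‖V g - f‖ ≤ ε) {ε : ℝ} (hε : 0 < ε) :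
    ∃ p ∈ Trig, Box p ∧ ‖V p - PW V f‖ ≤ ε := by
  set d := ‖f - PW V f‖ with hd
  have hd0 : 0 ≤ d := norm_nonneg _
  obtain ⟨η, hη, hη1⟩ : ∃ η : ℝ, 0 < η ∧ (d + 4 * η) ^ 2 ≤ d ^ 2 + ε ^ 2 := by
    refine ⟨min 1 (ε ^ 2 / (8 * d + 16)), by positivity, ?_⟩
    set η := min 1 (ε ^ 2 / (8 * d + 16)) with hη
    have h0 : 0 < η := by positivity
    have h1 : η ≤ 1 := min_le_left _ _
    have h2 : η ≤ ε ^ 2 / (8 * d + 16) := min_le_right _ _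
    rw [le_div_iff₀ (by positivity)] at h2
    nlinarith
  obtain ⟨s0, hs0, hs0'⟩ := TW_approx (PW_mem (V := V) f) hη
  obtain ⟨g, hg, hgf⟩ := hf η hη
  have hre : (fun n => (((s0 n).re : ℝ) : ℂ)) ∈ Trig := by
    have := Trig.smul_mem (1 / 2 : ℂ) (Trig.add_mem hs0 (trig_conj hs0))
    convert this using 1
    funext n
    simp only [Pi.smul_apply, Pi.add_apply, smul_eq_mul, Complex.re_eq_add_conj]
    ring
  obtain ⟨p, hp, hpb, hpc⟩ := trig_clamp hre hη
  refine ⟨p, hp, hpb, ?_⟩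
  set cl : ℕ → ℂ := fun n => ((max 0 (min ((s0 n).re) 1) : ℝ) : ℂ) with hcl
  have hclb : Bd cl := ⟨1, fun n => by
    simp only [hcl]
    rw [Complex.norm_real, Real.norm_of_nonneg (le_max_left _ _)]
    exact max_le zero_le_one (min_le_right _ _)⟩
  have a1 : ‖V (p - cl)‖ ≤ η := hS.norm_V_le hpc
  have a2 : ‖V (g - cl)‖ ≤ ‖V (g - s0)‖ := by
    refine hS.norm_V_mono (hg.bd.sub hclb) (hg.bd.sub (trig_bd hs0)) fun n => ?_
    simp only [Pi.sub_apply, hcl]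
    have b1 := Complex.le_def.1 (hg n).1
    have b2 := Complex.le_def.1 (hg n).2
    simp only [Complex.zero_re, Complex.one_re] at b1 b2
    have e : g n = ((g n).re : ℂ) := Complex.ext (by simp) (by simpa using b1.2.symm)
    have b3 := Complex.abs_re_le_norm (g n - s0 n)
    refine le_trans ?_ b3
    rw [e, ← Complex.ofReal_sub, Complex.norm_real, Real.norm_eq_abs, Complex.sub_re, Complex.ofReal_re]
    generalize (g n).re = x at *
    generalize (s0 n).re = y at *
    rcases le_total y 0 with h | h
    · rw [min_eq_left (by linarith), max_eq_left h, abs_of_nonneg (by linarith), abs_of_nonneg (by linarith)]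
      linarith
    · rcases le_total y 1 with h' | h'
      · rw [min_eq_left h', max_eq_right h]
      · rw [min_eq_right h', max_eq_right zero_le_one, abs_of_nonpos (by linarith), abs_of_nonpos (by linarith)]
        linarith
  rw [map_sub] at a1 a2
  rw [map_sub] at a2
  have a3 : ‖f - V p‖ ≤ d + 4 * η := by
    have e : f - V p = -(V g - f) + (V g - V cl) - (V p - V cl) := by abel
    have e2 : V g - V s0 = (V g - f) + (f - PW V f) - (V s0 - PW V f) := by abel
    have c1 := norm_sub_le (-(V g - f) + (V g - V cl)) (V p - V cl)
    have c2 := norm_add_le (-(V g - f)) (V g - V cl)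
    have c3 := norm_sub_le ((V g - f) + (f - PW V f)) (V s0 - PW V f)
    have c4 := norm_add_le (V g - f) (f - PW V f)
    rw [← e] at c1
    rw [← e2] at c3
    rw [norm_neg] at c2
    linarith
  have a4 : ‖f - V p‖ * ‖f - V p‖ = d * d + ‖V p - PW V f‖ * ‖V p - PW V f‖ := by
    have e : f - V p = (f - PW V f) + -(V p - PW V f) := by abel
    rw [e, norm_add_sq_eq_norm_sq_add_norm_sq_of_inner_eq_zero (𝕜 := ℂ), norm_neg]
    rw [inner_neg_right, inner_sub_left, PW_inner' _ (Submodule.sub_mem _ (V_mem hp) (PW_mem f)), sub_self, neg_zero]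
  refine (sq_le_sq₀ (norm_nonneg _) hε.le).1 ?_
  have : ‖f - V p‖ ^ 2 ≤ (d + 4 * η) ^ 2 := pow_le_pow_left₀ (norm_nonneg _) a3 2
  nlinarith

lemma T_affine (hS : IsSys M V T) {a : ℕ → ℂ} (ha : Bd a) (ℓ n : ℕ) :
    T (V (fun N => a (ℓ * N + n))) = V (fun N => a (ℓ * N + (n + ℓ))) := by
  rw [hS.T_V _ (ha.comp _)]
  congr 1
  funext N
  congr 1
  ring

lemma exists_q (hS : IsSys M V T) {a : ℕ → ℂ} (ha : Box a) (ℓ : ℕ) (hℓ : 0 < ℓ) {ε : ℝ} (hε : 0 < ε) :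
    ∃ q ∈ Trig, Box q ∧ ∀ n, ‖V (fun N => q (ℓ * N + n)) - PW V (V (fun N => a (ℓ * N + n)))‖ ≤ ε := by
  have h1 : ∀ n, ∃ p ∈ Trig, Box p ∧ ‖V p - PW V (V (fun N => a (ℓ * N + n)))‖ ≤ ε := fun n =>
    hS.box_approx (fun ε hε => ⟨fun N => a (ℓ * N + n), fun N => ha _, by simpa using hε.le⟩) hε
  choose p hp hpb hpn using h1
  have hq := trig_glue ℓ hℓ p hp
  refine ⟨_, hq, fun n => hpb _ _, fun n => ?_⟩
  induction n using Nat.strong_induction_on with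
  | _ n ih =>
    rcases lt_or_ge n ℓ with h | h
    · have : (fun N => (fun n => p (n % ℓ) (n / ℓ)) (ℓ * N + n)) = p n := by
        funext N
        simp only [Nat.mul_add_mod, Nat.mod_eq_of_lt h, Nat.mul_add_div hℓ, Nat.div_eq_of_lt h, add_zero]
      rw [this]
      exact hpn n
    · obtain ⟨k, rfl⟩ := Nat.exists_eq_add_of_le' h
      rw [← hS.T_affine (trig_bd hq), ← hS.T_affine ha.bd, hS.PW_T, ← map_sub, LinearIsometryEquiv.norm_map]
      exact ih k (by omega)

/-- Vanishing of the correlation on bad sets. -/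
lemma bad_corr (hS : IsSys M V T) {a : ℕ → ℂ} (ha : Box a) (ℓ m t : ℕ) (hm : 0 < m)
    (β : ℕ → ℕ → ℂ) (hβ : ∀ L, Box (β L)) (v : H) (hv : Tendsto (fun L => V (β L)) atTop (𝓝 v)) (K : ℕ)
    (hbad : ∀ L L' b N, K ≤ b → b ≤ L → β L' b = 0 ∨ β L N * a (ℓ * N + m * b + t) = 0)
    (z : Circle) (U : H ≃ₗᵢ[ℂ] H) (hU : ∀ f, Bd f → U (V f) = V (fun n => ch z n * f n)) :
    inner ℂ (V (fun b => conj (ch z b * inner ℂ (U v) (PW V (V (fun N => a (ℓ * N + (m * b + t)))))))) v = 0 := by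
  set AA : ℕ → H := fun n => V (fun N => a (ℓ * N + n)) with hAA
  have hAAn : ∀ n, ‖AA n‖ ≤ 1 := fun n => hS.norm_V_le fun N => ha.norm_le _
  set g : ℕ → ℂ := fun b => inner ℂ (U v) (PW V (AA (m * b + t))) with hg
  have hgb : ∀ b, ‖g b‖ ≤ ‖v‖ * 1 := fun b => (norm_inner_le_norm _ _).trans
    (mul_le_mul (U.norm_map v).le ((PW_norm _).trans (hAAn _)) (norm_nonneg _) (norm_nonneg _))
  have hgB : Bd g := ⟨_, hgb⟩
  have hcB : Bd (fun b => conj (ch z b * g b)) := ((Bd.ch z).mul hgB).conj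
  have key : ∀ L', M (fun b => ch z b * g b * β L' b) = 0 := by
    intro L'
    set D : ℕ → H := fun n => AA n - PW V (AA n) with hD
    have hcomp : V (fun b => inner ℂ (D (m * b + t)) (U v)) = 0 := by
      refine hS.compactness D 2 (fun n => ?_) ℓ m hm (fun n => ?_) (fun z v hv n => ?_) (U v) t
      · refine (norm_sub_le _ _).trans ?_
        linarith [PW_norm (V := V) (AA n), hAAn n]
      · simp only [hD, map_sub, hAA]
        rw [← hS.PW_T, hS.T_affine ha.bd]
      · obtain ⟨c, rfl⟩ := hS.eigen z v hv
        simp only [hD]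
        rw [inner_sub_left, PW_inner' _ (Submodule.smul_mem _ _ (V_mem (ch_mem z))), sub_self]
    have hDb : Bd (fun b => inner ℂ (D (m * b + t)) (U v)) := by
      refine ⟨2 * ‖v‖, fun b => (norm_inner_le_norm _ _).trans ?_⟩
      rw [U.norm_map]
      refine mul_le_mul_of_nonneg_right ((norm_sub_le _ _).trans ?_) (norm_nonneg _)
      linarith [PW_norm (V := V) (AA (m * b + t)), hAAn (m * b + t)]
    have hAb : Bd (fun b => inner ℂ (U v) (AA (m * b + t))) := by
      refine ⟨‖v‖ * 1, fun b => (norm_inner_le_norm _ _).trans ?_⟩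
      exact mul_le_mul (U.norm_map v).le (hAAn _) (norm_nonneg _) (norm_nonneg _)
    have e : (fun b => ch z b * g b * β L' b) =
        (fun b => ch z b * inner ℂ (U v) (AA (m * b + t)) * β L' b) -
        fun b => ch z b * conj (inner ℂ (D (m * b + t)) (U v)) * β L' b := by
      funext b
      simp only [Pi.sub_apply, hg, hD, inner_conj_symm, inner_sub_right]
      ring
    have z1 : M (fun b => ch z b * inner ℂ (U v) (AA (m * b + t)) * β L' b) = 0 := by
      rw [← hS.shift_iter (((Bd.ch z).mul hAb).mul (hβ L').bd) K]
      convert M_zero M using 2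
      funext b
      by_cases hb : β L' (b + K) = 0
      · rw [hb, mul_zero]
      · have h0 : ∀ L, b + K ≤ L → inner ℂ (U (V (β L))) (AA (m * (b + K) + t)) = 0 := by
          intro L hL
          rw [hU _ (hβ L).bd, hS.inn _ _ ((Bd.ch z).mul (hβ L).bd) (ha.bd.comp _)]
          convert M_zero M using 2
          funext N
          have := (hbad L L' (b + K) N (by omega) hL).resolve_left hb
          rw [map_mul, (hβ L).conj, mul_assoc, ← add_assoc, this, mul_zero]
        have h1 : Tendsto (fun L => inner ℂ (U (V (β L))) (AA (m * (b + K) + t))) atTop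
            (𝓝 (inner ℂ (U v) (AA (m * (b + K) + t)))) :=
          ((U.continuous.tendsto _).comp hv).inner tendsto_const_nhds
        have h2 : Tendsto (fun L => inner ℂ (U (V (β L))) (AA (m * (b + K) + t))) atTop (𝓝 0) :=
          tendsto_const_nhds.congr' ((eventually_ge_atTop (b + K)).mono fun L hL => (h0 L hL).symm)
        rw [tendsto_nhds_unique h1 h2]
        simp
    have z2 : M (fun b => ch z b * conj (inner ℂ (D (m * b + t)) (U v)) * β L' b) = 0 := by
      have hB := ((Bd.ch z).mul hDb.conj).mul (hβ L').bd
      have := hS.norm_V_mono hB hDb (fun b => by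
        rw [norm_mul, norm_mul, norm_ch, one_mul, RCLike.norm_conj]
        exact mul_le_of_le_one_right (norm_nonneg _) ((hβ L').norm_le b))
      rw [hcomp, norm_zero] at this
      exact norm_le_zero_iff.1 ((hS.norm_M_le_V hB).trans this)
    rw [e, map_sub, z1, z2, sub_zero]
  have h1 : ∀ L, inner ℂ (V (fun b => conj (ch z b * g b))) (V (β L)) = 0 := by
    intro L
    rw [hS.inn _ _ hcB (hβ L).bd, ← key L]
    congr 1
    funext b
    rw [Complex.conj_conj]
  have h2 : Tendsto (fun L => inner ℂ (V (fun b => conj (ch z b * g b))) (V (β L))) atTop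
      (𝓝 (inner ℂ (V (fun b => conj (ch z b * g b))) v)) := tendsto_const_nhds.inner hv
  simp only [h1] at h2
  exact (tendsto_nhds_unique tendsto_const_nhds h2).symm

end IsSys

open Filter MeasureTheory Topology
open scoped ComplexOrder ComplexConjugate

lemma tendsto_eps (C : ℝ) : Tendsto (fun j : ℕ => C * (1 / ((j : ℝ) + 1))) atTop (𝓝 0) := by
  simpa using tendsto_one_div_add_atTop_nhds_zero_nat.const_mul C

namespace IsSys
variable {H : Type} [NormedAddCommGroup H] [InnerProductSpace ℂ H] [CompleteSpace H]
  {M : (ℕ → ℂ) →ₗ[ℂ] ℂ} {V : (ℕ → ℂ) →ₗ[ℂ] H} {T : H ≃ₗᵢ[ℂ] H}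

/-- `M (z^b p_j g_j) → 0`. -/
lemma corr_zero (hS : IsSys M V T) {a : ℕ → ℂ} (ha : Box a) (ℓ m t : ℕ) (hm : 0 < m)
    (β : ℕ → ℕ → ℂ) (hβ : ∀ L, Box (β L)) (v : H) (hv : Tendsto (fun L => V (β L)) atTop (𝓝 v)) (K : ℕ)
    (hbad : ∀ L L' b N, K ≤ b → b ≤ L → β L' b = 0 ∨ β L N * a (ℓ * N + m * b + t) = 0)
    (q : ℕ → ℕ → ℂ) (hq : ∀ j, q j ∈ Trig) (hqb : ∀ j, Box (q j))
    (hqa : ∀ j n, ‖V (fun N => q j (ℓ * N + n)) - PW V (V (fun N => a (ℓ * N + n)))‖ ≤ 1 / ((j : ℝ) + 1))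
    (p : ℕ → ℕ → ℂ) (hp : ∀ j, p j ∈ Trig) (hpb : ∀ j, Box (p j))
    (hpv : ∀ j, ‖V (p j) - PW V v‖ ≤ 1 / ((j : ℝ) + 1)) (z : Circle) :
    Tendsto (fun j => M (fun b => ch z b * p j b *
      M (fun N => conj (ch z N * p j N) * q j (ℓ * N + m * b + t)))) atTop (𝓝 0) := by
  obtain ⟨U, hU⟩ := hS.toIsModel.exists_mulch z
  have h0 := hS.bad_corr ha ℓ m t hm β hβ v hv K hbad z U hU
  have hv1 : ‖v‖ ≤ 1 := le_of_tendsto hv.norm (Eventually.of_forall fun L => hS.norm_V_le (hβ L).norm_le)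
  set AA : ℕ → H := fun n => V (fun N => a (ℓ * N + n)) with hAA
  have hAAn : ∀ n, ‖AA n‖ ≤ 1 := fun n => hS.norm_V_le fun N => ha.norm_le _
  set g : ℕ → ℂ := fun b => inner ℂ (U v) (PW V (AA (m * b + t))) with hg
  set gj : ℕ → ℕ → ℂ := fun j b => M (fun N => conj (ch z N * p j N) * q j (ℓ * N + m * b + t)) with hgj
  have hgjT : ∀ j, gj j ∈ Trig := fun j => by
    have := trig_M M (fun N => conj (ch z N * p j N)) (trig_const 1) (hq j) ℓ m t
    simpa only [mul_one] using this
  have hgjd : ∀ j b, ‖gj j b - g b‖ ≤ 2 * (1 / ((j : ℝ) + 1)) := by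
    intro j b
    have e1 : gj j b = inner ℂ (U (V (p j))) (V (fun N => q j (ℓ * N + (m * b + t)))) := by
      rw [hU _ (hpb j).bd, hS.inn _ _ ((Bd.ch z).mul (hpb j).bd) ((hqb j).bd.comp _)]
      simp only [hgj, add_assoc]
    have e2 : g b = inner ℂ (U (PW V v)) (PW V (AA (m * b + t))) := by
      simp only [hg]
      rw [← hS.PW_U z U hU, PW_inner' _ (PW_mem _)]
    have e3 : gj j b - g b = inner ℂ (U (V (p j) - PW V v)) (V (fun N => q j (ℓ * N + (m * b + t)))) +
        inner ℂ (U (PW V v)) (V (fun N => q j (ℓ * N + (m * b + t))) - PW V (AA (m * b + t))) := by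
      rw [e1, e2, map_sub, inner_sub_left, inner_sub_right]
      ring
    rw [e3]
    refine (norm_add_le _ _).trans ?_
    have b1 := norm_inner_le_norm (𝕜 := ℂ) (U (V (p j) - PW V v)) (V (fun N => q j (ℓ * N + (m * b + t))))
    have b2 := norm_inner_le_norm (𝕜 := ℂ) (U (PW V v)) (V (fun N => q j (ℓ * N + (m * b + t))) - PW V (AA (m * b + t)))
    rw [U.norm_map] at b1 b2
    have c1 : ‖V (fun N => q j (ℓ * N + (m * b + t)))‖ ≤ 1 := hS.norm_V_le fun N => (hqb j).norm_le _
    have c2 := (PW_norm (V := V) v).trans hv1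
    have d1 := mul_le_mul (hpv j) c1 (norm_nonneg _) ((norm_nonneg _).trans (hpv j))
    have d2 := mul_le_mul c2 (hqa j (m * b + t)) (norm_nonneg _) zero_le_one
    linarith
  have hgB : Bd g := ⟨1, fun b => by
    refine (norm_inner_le_norm _ _).trans ?_
    rw [U.norm_map]
    exact mul_le_one₀ hv1 (norm_nonneg _) ((PW_norm _).trans (hAAn _))⟩
  set G : ℕ → ℂ := fun b => conj (ch z b * g b) with hG
  set Gj : ℕ → ℕ → ℂ := fun j b => conj (ch z b * gj j b) with hGj
  have hGT : ∀ j, Gj j ∈ Trig := fun j => trig_conj (trig_mul (ch_mem z) (hgjT j))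
  have hGd : ∀ j, ‖V (Gj j) - V G‖ ≤ 2 * (1 / ((j : ℝ) + 1)) := fun j => by
    rw [← map_sub]
    refine hS.norm_V_le fun b => ?_
    simp only [Pi.sub_apply, hGj, hG]
    rw [← map_sub, RCLike.norm_conj, ← mul_sub, norm_mul, norm_ch, one_mul]
    exact hgjd j b
  have hGlim : Tendsto (fun j => V (Gj j)) atTop (𝓝 (V G)) := by
    rw [tendsto_iff_norm_sub_tendsto_zero]
    exact squeeze_zero (fun _ => norm_nonneg _) hGd (tendsto_eps 2)
  have hplim : Tendsto (fun j => V (p j)) atTop (𝓝 (PW V v)) := by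
    rw [tendsto_iff_norm_sub_tendsto_zero]
    exact squeeze_zero (fun _ => norm_nonneg _) hpv (by simpa using tendsto_eps 1)
  have hGW : V G ∈ TW V := (Submodule.isClosed_topologicalClosure _).mem_of_tendsto hGlim
    (Eventually.of_forall fun j => V_mem (hGT j))
  have hlim := hGlim.inner (𝕜 := ℂ) hplim
  rw [PW_inner v hGW, h0] at hlim
  refine hlim.congr fun j => ?_
  rw [hS.inn _ _ (trig_bd (hGT j)) (hpb j).bd]
  congr 1
  funext b
  simp only [hGj, hgj, Complex.conj_conj]
  ring

/-- The main estimate. -/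
lemma main_claim (hS : IsSys M V T) {a : ℕ → ℂ} (ha : Box a) (ℓ m t : ℕ) (hℓ : 0 < ℓ) (hm : 0 < m)
    (β : ℕ → ℕ → ℂ) (hβ : ∀ L, Box (β L)) (v : H) (hv : Tendsto (fun L => V (β L)) atTop (𝓝 v)) (K : ℕ)
    (hbad : ∀ L L' b N, K ≤ b → b ≤ L → β L' b = 0 ∨ β L N * a (ℓ * N + m * b + t) = 0)
    (q : ℕ → ℕ → ℂ) (hq : ∀ j, q j ∈ Trig) (hqb : ∀ j, Box (q j))
    (hqa : ∀ j n, ‖V (fun N => q j (ℓ * N + n)) - PW V (V (fun N => a (ℓ * N + n)))‖ ≤ 1 / ((j : ℝ) + 1)) :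
    Tendsto (fun j => inner ℂ v (V (fun N => q j ((ℓ + m) * N + t)))) atTop (𝓝 0) := by
  have hp1 : ∀ j : ℕ, ∃ p ∈ Trig, Box p ∧ ‖V p - PW V v‖ ≤ 1 / ((j : ℝ) + 1) := fun j =>
    hS.box_approx (fun ε hε => by
      obtain ⟨L, hL⟩ := (Metric.tendsto_atTop.1 hv) ε hε
      have := hL L le_rfl
      rw [dist_eq_norm] at this
      exact ⟨β L, hβ L, this.le⟩) (by positivity)
  choose p hp hpb hpv using hp1
  have hz := hS.corr_zero ha ℓ m t hm β hβ v hv K hbad q hq hqb hqa p hp hpb hpv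
  have hr : 0 < ℓ + m := by omega
  have hpd : ∀ i j, ‖V (p i - p j)‖ ≤ 1 / ((i : ℝ) + 1) + 1 / ((j : ℝ) + 1) := fun i j => by
    have e : V (p i - p j) = (V (p i) - PW V v) - (V (p j) - PW V v) := by rw [map_sub]; abel
    rw [e]
    exact (norm_sub_le _ _).trans (add_le_add (hpv i) (hpv j))
  have hqd : ∀ i j n, ‖V (fun N => (q i - q j) ((ℓ + m) * N + n))‖ ≤
      ((ℓ + m : ℕ) : ℝ) * (1 / ((i : ℝ) + 1) + 1 / ((j : ℝ) + 1)) := fun i j n => by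
    refine hS.norm_of_dil (Trig.sub_mem (hq i) (hq j)) ℓ hℓ _ (fun n => ?_) (ℓ + m) n hr
    have e : V (fun N => (q i - q j) (ℓ * N + n)) = (V (fun N => q i (ℓ * N + n)) - PW V (V (fun N => a (ℓ * N + n)))) -
        (V (fun N => q j (ℓ * N + n)) - PW V (V (fun N => a (ℓ * N + n)))) := by
      rw [sub_sub_sub_cancel_right, ← map_sub]; rfl
    rw [e]
    exact (norm_sub_le _ _).trans (add_le_add (hqa i n) (hqa j n))
  set Y : ℕ → ℕ → ℂ := fun j u => M (fun N => p j N * p j (N + u) * q j ((ℓ + m) * N + m * u + t)) with hY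
  have hYT : ∀ j, Y j ∈ Trig := fun j => trig_M M (p j) (hp j) (hq j) (ℓ + m) m t
  set C : ℝ := 2 + ((ℓ + m : ℕ) : ℝ) with hC
  have mulle : ∀ f h : ℕ → ℂ, Bd f → (∀ n, ‖h n‖ ≤ 1) → ‖M (fun n => f n * h n)‖ ≤ ‖V f‖ := fun f h hf hh => by
    have hB := hf.mul ⟨1, hh⟩
    refine (hS.norm_M_le_V hB).trans (hS.norm_V_mono hB hf fun n => ?_)
    rw [norm_mul]
    exact mul_le_of_le_one_right (norm_nonneg _) (hh n)
  have hYd : ∀ i j u, ‖Y i u - Y j u‖ ≤ C * (1 / ((i : ℝ) + 1) + 1 / ((j : ℝ) + 1)) := by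
    intro i j u
    have e : Y i u - Y j u =
        M (fun N => (p i - p j) N * (p i (N + u) * q i ((ℓ + m) * N + m * u + t))) +
        M (fun N => (fun N => (p i - p j) (N + u)) N * (p j N * q i ((ℓ + m) * N + m * u + t))) +
        M (fun N => (fun N => (q i - q j) ((ℓ + m) * N + (m * u + t))) N * (p j N * p j (N + u))) := by
      simp only [hY]
      rw [← map_sub, ← map_add, ← map_add]
      congr 1
      funext N
      simp only [Pi.add_apply, Pi.sub_apply, ← add_assoc]
      ring
    have hTd := Trig.sub_mem (hp i) (hp j)
    have hTq := Trig.sub_mem (hq i) (hq j)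
    have b1 := mulle (p i - p j) (fun N => p i (N + u) * q i ((ℓ + m) * N + m * u + t)) (trig_bd hTd) (fun N => by
      rw [norm_mul]; exact mul_le_one₀ ((hpb i).norm_le _) (norm_nonneg _) ((hqb i).norm_le _))
    have b2 := mulle (fun N => (p i - p j) (N + u)) (fun N => p j N * q i ((ℓ + m) * N + m * u + t))
      ((trig_bd hTd).comp _) (fun N => by
      rw [norm_mul]; exact mul_le_one₀ ((hpb j).norm_le _) (norm_nonneg _) ((hqb i).norm_le _))
    have b3 := mulle (fun N => (q i - q j) ((ℓ + m) * N + (m * u + t))) (fun N => p j N * p j (N + u))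
      ((trig_bd hTq).comp _) (fun N => by
      rw [norm_mul]; exact mul_le_one₀ ((hpb j).norm_le _) (norm_nonneg _) ((hpb j).norm_le _))
    rw [hS.norm_shift hTd u] at b2
    rw [e]
    refine (norm_add₃_le).trans ?_
    have := hpd i j
    have := hqd i j (m * u + t)
    rw [hC, add_mul]
    linarith
  -- pointwise limit
  have hlim : ∀ u, ∃ y, Tendsto (fun j => Y j u) atTop (𝓝 y) := by
    intro u
    refine cauchySeq_tendsto_of_complete (Metric.cauchySeq_iff'.2 fun ε hε => ?_)
    have hC0 : 0 ≤ C := by positivity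
    obtain ⟨n, hn⟩ := ((tendsto_eps (2 * C)).eventually (gt_mem_nhds hε)).exists
    refine ⟨n, fun k hk => ?_⟩
    rw [dist_eq_norm]
    refine (hYd k n u).trans_lt (lt_of_le_of_lt ?_ hn)
    have : 1 / ((k : ℝ) + 1) ≤ 1 / ((n : ℝ) + 1) :=
      one_div_le_one_div_of_le (by positivity) (by exact_mod_cast Nat.succ_le_succ hk)
    nlinarith
  choose y hy using hlim
  have hyd : ∀ j u, ‖Y j u - y u‖ ≤ C * (1 / ((j : ℝ) + 1)) := by
    intro j u
    have h1 : Tendsto (fun i => ‖Y j u - Y i u‖) atTop (𝓝 ‖Y j u - y u‖) := (tendsto_const_nhds.sub (hy u)).norm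
    have h2 : Tendsto (fun i : ℕ => C * (1 / ((j : ℝ) + 1) + 1 / ((i : ℝ) + 1))) atTop
        (𝓝 (C * (1 / ((j : ℝ) + 1) + 0))) :=
      (tendsto_const_nhds.add tendsto_one_div_add_atTop_nhds_zero_nat).const_mul C
    rw [add_zero] at h2
    exact le_of_tendsto_of_tendsto' h1 h2 fun i => hYd j i u
  have hVd : ∀ j, ‖V (Y j) - V y‖ ≤ C * (1 / ((j : ℝ) + 1)) := fun j => by
    rw [← map_sub]; exact hS.norm_V_le (hyd j)
  have hVlim : Tendsto (fun j => V (Y j)) atTop (𝓝 (V y)) := by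
    rw [tendsto_iff_norm_sub_tendsto_zero]
    exact squeeze_zero (fun _ => norm_nonneg _) hVd (tendsto_eps C)
  have hyW : V y ∈ TW V := (Submodule.isClosed_topologicalClosure _).mem_of_tendsto hVlim
    (Eventually.of_forall fun j => V_mem (hYT j))
  have hyo : ∀ z, inner ℂ (V (ch z)) (V y) = 0 := by
    intro z
    have h1 : Tendsto (fun j => inner ℂ (V (ch z)) (V (Y j))) atTop (𝓝 (inner ℂ (V (ch z)) (V y))) :=
      tendsto_const_nhds.inner hVlim
    refine tendsto_nhds_unique h1 ((hz z⁻¹).congr fun j => ?_)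
    have h2 := hS.two_var (trig_mul (ch_mem z⁻¹) (hp j)) (trig_conj (trig_mul (ch_mem z⁻¹) (hp j))) (hq j) ℓ m t
    rw [hS.inn _ _ (Bd.ch z) (trig_bd (hYT j))]
    simp only [Pi.mul_apply] at h2
    simp only [← M_cmul, ← mul_assoc]
    rw [h2]
    congr 1
    funext u
    simp only [hY]
    rw [← M_cmul]
    congr 1
    funext N
    rw [map_mul, (hpb j).conj]
    simp only [ch, Circle.coe_inv_eq_conj, map_pow, Complex.conj_conj]
    have hzz : conj (z : ℂ) ^ N * (z : ℂ) ^ N = 1 := by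
      rw [← mul_pow, ← Circle.coe_inv_eq_conj, ← Circle.coe_mul]; simp
    rw [pow_add]
    linear_combination (p j (N + u) * p j N * q j ((ℓ + m) * N + m * u + t) * conj (z : ℂ) ^ u) * hzz
  have hVy : V y = 0 := by
    have := (Submodule.mem_orthogonal _ _).1 (mem_orth hyo) (V y) hyW
    exact inner_self_eq_zero.1 this
  have hy0 : y 0 = 0 := by
    refine hS.ap_zero (fun ε hε => ?_) hVy
    obtain ⟨n, hn⟩ := ((tendsto_eps C).eventually (gt_mem_nhds hε)).exists
    refine ⟨Y n, hYT n, fun u => ?_⟩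
    rw [norm_sub_rev]
    exact (hyd n u).trans hn.le
  have hY0 : Tendsto (fun j => ‖Y j 0‖) atTop (𝓝 0) := by
    have := (hy 0).norm
    rwa [hy0, norm_zero] at this
  set Q : ℕ → ℕ → ℂ := fun j N => q j ((ℓ + m) * N + t) with hQ
  have hQT : ∀ j, Q j ∈ Trig := fun j => trig_affine (hq j) _ _
  have hQb : ∀ j, Box (Q j) := fun j N => hqb j _
  have hsq : ∀ j, ‖M (fun N => p j N * Q j N)‖ ^ 2 ≤ ‖Y j 0‖ := by
    intro j
    have hB := (hpb j).bd.mul (hQb j).bd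
    have h1 := hS.norm_M_le_V hB
    have h2 := hS.norm_sq hB
    have h3 : M (fun N => ((‖p j N * Q j N‖ ^ 2 : ℝ) : ℂ)) ≤ Y j 0 := by
      refine hS.mono ⟨1, fun N => ?_⟩ (((hpb j).bd.mul (hpb j).bd).mul (hQb j).bd) fun N => ?_
      · rw [Complex.norm_real, Real.norm_of_nonneg (by positivity), norm_mul]
        exact pow_le_one₀ (by positivity) (mul_le_one₀ ((hpb j).norm_le _) (norm_nonneg _) ((hQb j).norm_le _))
      · have e : ((‖p j N * Q j N‖ ^ 2 : ℝ) : ℂ) = p j N * p j N * Q j N * Q j N := by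
          push_cast
          rw [← Complex.conj_mul', map_mul, (hpb j).conj, (hQb j).conj]
          ring
        rw [e]
        exact mul_le_of_le_one_right (mul_nonneg (mul_nonneg (hpb j N).1 (hpb j N).1) (hQb j N).1) (hQb j N).2
    rw [← h2] at h3
    have h4 := (Complex.le_def.1 h3).1
    rw [Complex.ofReal_re] at h4
    calc ‖M (fun N => p j N * Q j N)‖ ^ 2 ≤ ‖V (fun N => p j N * Q j N)‖ ^ 2 := pow_le_pow_left₀ (norm_nonneg _) h1 2
      _ ≤ (Y j 0).re := h4
      _ ≤ ‖Y j 0‖ := Complex.re_le_norm _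
  have hMz : Tendsto (fun j => ‖M (fun N => p j N * Q j N)‖) atTop (𝓝 0) := by
    have h1 : Tendsto (fun j => Real.sqrt ‖Y j 0‖) atTop (𝓝 0) := by
      have := (Real.continuous_sqrt.tendsto 0).comp hY0
      rw [Real.sqrt_zero] at this
      exact this
    exact squeeze_zero (fun _ => norm_nonneg _) (fun j => Real.le_sqrt_of_sq_le (hsq j)) h1
  rw [tendsto_zero_iff_norm_tendsto_zero]
  have hfin : Tendsto (fun j : ℕ => ‖M (fun N => p j N * Q j N)‖ + 1 * (1 / ((j : ℝ) + 1))) atTop (𝓝 0) := by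
    simpa using hMz.add (tendsto_eps 1)
  refine squeeze_zero (fun _ => norm_nonneg _) (fun j => ?_) hfin
  have e : inner ℂ v (V (Q j)) = M (fun N => p j N * Q j N) - inner ℂ (V (p j) - PW V v) (V (Q j)) := by
    rw [inner_sub_left, PW_inner' v (V_mem (hQT j)), hS.inn _ _ (hpb j).bd (hQb j).bd]
    simp only [(hpb j).conj]
    ring
  change ‖inner ℂ v (V (Q j))‖ ≤ _
  rw [e]
  refine (norm_sub_le _ _).trans (add_le_add le_rfl ?_)
  refine (norm_inner_le_norm _ _).trans ?_
  have c1 : ‖V (Q j)‖ ≤ 1 := hS.norm_V_le (hQb j).norm_le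
  rw [mul_comm]
  exact mul_le_mul c1 (hpv j) (norm_nonneg _) zero_le_one

end IsSys

open Filter MeasureTheory Topology
open scoped ComplexOrder ComplexConjugate

/-- The bad set. -/
def BadS (A : Set ℕ) (ℓ m t K L : ℕ) : Set ℕ :=
  {N | ∀ b, K ≤ b → b ≤ L → (∀ j ≤ K, (ℓ * b + j ∈ A ↔ ℓ * N + j ∈ A)) → ℓ * N + m * b + t ∉ A}

/-- indicator -/
noncomputable def ind (A : Set ℕ) : ℕ → ℂ := A.indicator (fun _ => (1 : ℂ))

lemma ind_mem {A : Set ℕ} {n : ℕ} (h : n ∈ A) : ind A n = 1 := Set.indicator_of_mem h _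
lemma ind_not {A : Set ℕ} {n : ℕ} (h : n ∉ A) : ind A n = 0 := Set.indicator_of_notMem h _

lemma box_ind (A : Set ℕ) : Box (ind A) := fun n => by
  by_cases h : n ∈ A
  · rw [ind_mem h]; exact ⟨zero_le_one, le_rfl⟩
  · rw [ind_not h]; exact ⟨le_rfl, zero_le_one⟩

namespace IsSys
variable {H : Type} [NormedAddCommGroup H] [InnerProductSpace ℂ H] [CompleteSpace H]
  {M : (ℕ → ℂ) →ₗ[ℂ] ℂ} {V : (ℕ → ℂ) →ₗ[ℂ] H} {T : H ≃ₗᵢ[ℂ] H}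

lemma choose_t (hS : IsSys M V T) {a : ℕ → ℂ} (ha : Box a) (ℓ m : ℕ) (hℓ : 0 < ℓ)
    (q : ℕ → ℕ → ℂ) (hq : ∀ j, q j ∈ Trig) (hqb : ∀ j, Box (q j))
    (hqa : ∀ j n, ‖V (fun N => q j (ℓ * N + n)) - PW V (V (fun N => a (ℓ * N + n)))‖ ≤ 1 / ((j : ℝ) + 1))
    (hpos : 0 < (M (fun N => ∑ k ∈ Finset.range ℓ, a (ℓ * N + k))).re) :
    ∃ t : ℕ, 0 < t ∧ ∃ c : ℝ, 0 < c ∧ ∃ᶠ j in atTop, c ≤ (M (fun N => q j ((ℓ + m) * N + t))).re := by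
  set c0 := (M (fun N => ∑ k ∈ Finset.range ℓ, a (ℓ * N + k))).re with hc0
  have hℓ' : (0 : ℝ) < ℓ := by exact_mod_cast hℓ
  have hr : 0 < ℓ + m := by omega
  have hr' : (0 : ℝ) < ((ℓ + m : ℕ) : ℝ) := by exact_mod_cast hr
  have hc : 0 < c0 / (2 * ℓ) := by positivity
  have hsum : c0 = ∑ k ∈ Finset.range ℓ, (M (fun N => a (ℓ * N + k))).re := by
    rw [hc0, ← Complex.re_sum, ← map_sum]
    congr 2
    funext N
    rw [Finset.sum_apply]
  have hcl : ∀ (j k : ℕ), (M (fun N => a (ℓ * N + k))).re - 1 / ((j : ℝ) + 1) ≤ (M (fun N => q j (ℓ * N + k))).re := by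
    intro j k
    have e : M (fun N => a (ℓ * N + k)) - M (fun N => q j (ℓ * N + k)) =
        - inner ℂ (V fun _ => 1) (V (fun N => q j (ℓ * N + k)) - PW V (V (fun N => a (ℓ * N + k)))) := by
      rw [inner_sub_right, PW_inner _ (V_mem (trig_const 1)), hS.M_eq (ha.bd.comp _), hS.M_eq ((hqb j).bd.comp _)]
      ring
    have h1 : ‖M (fun N => a (ℓ * N + k)) - M (fun N => q j (ℓ * N + k))‖ ≤ 1 / ((j : ℝ) + 1) := by
      rw [e, norm_neg]
      refine (norm_inner_le_norm _ _).trans ?_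
      rw [hS.norm_V_one, one_mul]
      exact hqa j k
    have h2 := (Complex.re_le_norm _).trans h1
    rw [Complex.sub_re] at h2
    linarith
  have hev : ∀ᶠ j : ℕ in atTop, ∃ i ∈ Finset.range (ℓ + m), c0 / (2 * ℓ) ≤ (M (fun N => q j ((ℓ + m) * N + (1 + i)))).re := by
    have h1 : ∀ᶠ j : ℕ in atTop, (ℓ : ℝ) * (1 / ((j : ℝ) + 1)) < c0 / 2 :=
      (tendsto_eps ℓ).eventually (gt_mem_nhds (by positivity))
    filter_upwards [h1] with j hj
    by_contra hno
    push Not at hno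
    have d1 := congrArg Complex.re (hS.dilation (hq j) (ℓ + m) hr 1)
    have d2 := congrArg Complex.re (hS.dilation (hq j) ℓ hℓ 0)
    rw [Complex.re_sum, ← Complex.ofReal_natCast, Complex.re_ofReal_mul] at d1 d2
    have s1 : ∑ i ∈ Finset.range (ℓ + m), (M (fun N => q j ((ℓ + m) * N + (1 + i)))).re <
        ∑ i ∈ Finset.range (ℓ + m), c0 / (2 * ℓ) :=
      Finset.sum_lt_sum_of_nonempty ⟨0, Finset.mem_range.2 hr⟩ hno
    rw [d1, Finset.sum_const, Finset.card_range, nsmul_eq_mul] at s1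
    have s1' := lt_of_mul_lt_mul_left s1 hr'.le
    have s2 : ∑ k ∈ Finset.range ℓ, ((M (fun N => a (ℓ * N + k))).re - 1 / ((j : ℝ) + 1)) ≤
        ∑ k ∈ Finset.range ℓ, (M (fun N => q j (ℓ * N + (0 + k)))).re :=
      Finset.sum_le_sum fun k _ => by rw [zero_add]; exact hcl j k
    rw [d2, Finset.sum_sub_distrib, ← hsum, Finset.sum_const, Finset.card_range, nsmul_eq_mul] at s2
    rw [lt_div_iff₀ (by positivity)] at s1'
    nlinarith
  by_contra hno
  push Not at hno
  have hall : ∀ᶠ j : ℕ in atTop, ∀ i ∈ Finset.range (ℓ + m), ¬ c0 / (2 * ℓ) ≤ (M (fun N => q j ((ℓ + m) * N + (1 + i)))).re := by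
    rw [Filter.eventually_all_finset]
    intro i _
    have := hno (1 + i) (by omega) _ hc
    exact this.mono fun j hj => not_le.2 hj
  obtain ⟨j, ⟨i, hi, h1⟩, h2⟩ := (hev.and hall).exists
  exact h2 i hi h1

lemma exists_limit (hS : IsSys M V T) (S : ℕ → Set ℕ) (hmono : ∀ L L', L ≤ L' → S L' ⊆ S L) :
    ∃ v, Tendsto (fun L => V (ind (S L))) atTop (𝓝 v) := by
  set x : ℕ → ℝ := fun L => ‖V (ind (S L))‖ ^ 2 with hx
  have hd : ∀ L L', L ≤ L' → ‖V (ind (S L')) - V (ind (S L))‖ ^ 2 = x L - x L' := by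
    intro L L' h
    rw [← map_sub]
    have h1 := hS.norm_sq ((box_ind (S L')).bd.sub (box_ind (S L)).bd)
    have h2 := hS.norm_sq (box_ind (S L)).bd
    have h3 := hS.norm_sq (box_ind (S L')).bd
    have : ((‖V (ind (S L') - ind (S L))‖ ^ 2 : ℝ) : ℂ) = ((x L - x L' : ℝ) : ℂ) := by
      rw [Complex.ofReal_sub, hx, h1, h2, h3, ← map_sub]
      congr 1
      funext n
      simp only [Pi.sub_apply]
      by_cases a1 : n ∈ S L'
      · rw [ind_mem a1, ind_mem (hmono L L' h a1)]; simp
      · rw [ind_not a1]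
        by_cases a2 : n ∈ S L
        · rw [ind_mem a2]; simp
        · rw [ind_not a2]; simp
    exact_mod_cast this
  have hxa : Antitone x := fun L L' h => by
    have := hd L L' h
    nlinarith [sq_nonneg ‖V (ind (S L')) - V (ind (S L))‖]
  have hxb : BddBelow (Set.range x) := ⟨0, by rintro _ ⟨L, rfl⟩; positivity⟩
  have hlim := tendsto_atTop_ciInf hxa hxb
  refine cauchySeq_tendsto_of_complete (Metric.cauchySeq_iff'.2 fun ε hε => ?_)
  have hlt : (⨅ i, x i) < (⨅ i, x i) + ε ^ 2 := by linarith [pow_pos hε 2]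
  obtain ⟨L, hL⟩ := (hlim.eventually (gt_mem_nhds hlt)).exists
  refine ⟨L, fun L' h => ?_⟩
  rw [dist_eq_norm]
  refine (sq_lt_sq₀ (norm_nonneg _) hε.le).1 ?_
  rw [hd L L' h]
  have := ciInf_le hxb L'
  linarith

lemma bad_small (hS : IsSys M V T) (A : Set ℕ) (ℓ m t : ℕ) (hℓ : 0 < ℓ) (hm : 0 < m)
    (q : ℕ → ℕ → ℂ) (hq : ∀ j, q j ∈ Trig) (hqb : ∀ j, Box (q j))
    (hqa : ∀ j n, ‖V (fun N => q j (ℓ * N + n)) - PW V (V (fun N => ind A (ℓ * N + n)))‖ ≤ 1 / ((j : ℝ) + 1))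
    (K : ℕ) {δ : ℝ} (hδ : 0 < δ) :
    ∃ L, ∀ᶠ j in atTop, ‖M (fun N => ind (BadS A ℓ m t K L) N * q j ((ℓ + m) * N + t))‖ ≤ δ := by
  classical
  let wd : ℕ → Finset ℕ := fun N => (Finset.range (K + 1)).filter fun j => ℓ * N + j ∈ A
  have hwd : ∀ b N, wd b = wd N → ∀ j ≤ K, (ℓ * b + j ∈ A ↔ ℓ * N + j ∈ A) := by
    intro b N h j hj
    have h1 : j ∈ wd b ↔ j ∈ wd N := by rw [h]
    simpa [wd, Nat.lt_succ_of_le hj, hj] using h1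
  let S : Finset ℕ → ℕ → Set ℕ := fun w L => {N | wd N = w ∧ N ∈ BadS A ℓ m t K L}
  have hone : ∀ w, ∀ δ : ℝ, 0 < δ → ∀ᶠ L in atTop, ∀ᶠ j in atTop,
      ‖M (fun N => ind (S w L) N * q j ((ℓ + m) * N + t))‖ ≤ δ := by
    intro w δ hδ
    obtain ⟨v, hv⟩ := hS.exists_limit (S w) (fun L L' h N hN =>
      ⟨hN.1, fun b hb hbL => hN.2 b hb (hbL.trans h)⟩)
    have hmain := hS.main_claim (box_ind A) ℓ m t hℓ hm (fun L => ind (S w L)) (fun L => box_ind _) v hv K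
      (fun L L' b N hKb hbL => by
        by_cases h1 : b ∈ S w L'
        · right
          by_cases h2 : N ∈ S w L
          · have := h2.2 b hKb hbL (hwd b N (h1.1.trans h2.1.symm))
            rw [ind_not this, mul_zero]
          · rw [ind_not h2, zero_mul]
        · left; exact ind_not h1) q hq hqb hqa
    have e1 : ∀ᶠ L in atTop, ‖V (ind (S w L)) - v‖ < δ / 2 := by
      have := tendsto_iff_norm_sub_tendsto_zero.1 hv
      exact this.eventually (gt_mem_nhds (by positivity))
    filter_upwards [e1] with L hL
    have e2 := (tendsto_zero_iff_norm_tendsto_zero.1 hmain).eventually (gt_mem_nhds (half_pos hδ))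
    filter_upwards [e2] with j hj
    have hQ : ‖V (fun N => q j ((ℓ + m) * N + t))‖ ≤ 1 := hS.norm_V_le fun N => (hqb j).norm_le _
    have e3 : M (fun N => ind (S w L) N * q j ((ℓ + m) * N + t)) =
        inner ℂ (V (ind (S w L)) - v) (V (fun N => q j ((ℓ + m) * N + t))) +
        inner ℂ v (V (fun N => q j ((ℓ + m) * N + t))) := by
      rw [inner_sub_left, sub_add_cancel, hS.inn _ _ (box_ind _).bd ((hqb j).bd.comp _)]
      simp only [(box_ind (S w L)).conj]
    rw [e3]
    refine (norm_add_le _ _).trans ?_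
    have e4 := norm_inner_le_norm (𝕜 := ℂ) (V (ind (S w L)) - v) (V (fun N => q j ((ℓ + m) * N + t)))
    have e5 := mul_le_mul hL.le hQ (norm_nonneg _) (half_pos hδ).le
    linarith
  set W := (Finset.range (K + 1)).powerset with hW
  have hc : (0 : ℝ) < W.card := by
    rw [hW]; exact_mod_cast Finset.card_pos.2 ⟨∅, Finset.empty_mem_powerset _⟩
  have hall : ∀ᶠ L in atTop, ∀ w ∈ W, ∀ᶠ j in atTop,
      ‖M (fun N => ind (S w L) N * q j ((ℓ + m) * N + t))‖ ≤ δ / W.card := by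
    rw [Filter.eventually_all_finset]
    intro w _
    exact hone w _ (by positivity)
  obtain ⟨L, hL⟩ := hall.exists
  refine ⟨L, ?_⟩
  rw [← Filter.eventually_all_finset] at hL
  filter_upwards [hL] with j hj
  have e : (fun N => ind (BadS A ℓ m t K L) N * q j ((ℓ + m) * N + t)) =
      ∑ w ∈ W, fun N => ind (S w L) N * q j ((ℓ + m) * N + t) := by
    funext N
    rw [Finset.sum_apply, ← Finset.sum_mul]
    congr 1
    have hmem : wd N ∈ W := Finset.mem_powerset.2 (Finset.filter_subset _ _)
    rw [Finset.sum_eq_single_of_mem (wd N) hmem]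
    · by_cases h : N ∈ BadS A ℓ m t K L
      · rw [ind_mem h, ind_mem (show N ∈ S (wd N) L from ⟨rfl, h⟩)]
      · rw [ind_not h, ind_not (show N ∉ S (wd N) L from fun h' => h h'.2)]
    · intro w _ hw
      exact ind_not fun h' => hw h'.1.symm
  rw [e, map_sum]
  refine (norm_sum_le _ _).trans ((Finset.sum_le_sum hj).trans ?_)
  rw [Finset.sum_const, nsmul_eq_mul, mul_div_cancel₀ _ hc.ne']

end IsSys

lemma exists_good (ℓ m : ℕ) (hℓ : 0 < ℓ) (hm : 0 < m) (A : Set ℕ) (hA : 0 < upperBanachDensity A) :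
    ∃ t : ℕ, 0 < t ∧ ∃ L : ℕ → ℕ, ∀ n, ∃ N, ∀ K ≤ n, N ∉ BadS A ℓ m t K (L K) := by
  obtain ⟨H, _, _, _, M, V, T, hS, hpos⟩ := exists_sys ℓ hℓ A hA
  have h1 : ∀ j : ℕ, _ := fun j => hS.exists_q (box_ind A) ℓ hℓ (ε := 1 / ((j : ℝ) + 1)) (by positivity)
  choose q hq hqb hqa using h1
  obtain ⟨t, ht, c, hc, hfr⟩ := hS.choose_t (box_ind A) ℓ m hℓ q hq hqb hqa hpos
  have h2 := fun K : ℕ => hS.bad_small A ℓ m t hℓ hm q hq hqb hqa K (δ := c / 4 * (1 / 2) ^ K) (by positivity)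
  choose L hL using h2
  refine ⟨t, ht, L, fun n => ?_⟩
  have h3 : ∀ᶠ j in atTop, ∀ K ∈ Finset.range (n + 1),
      ‖M (fun N => ind (BadS A ℓ m t K (L K)) N * q j ((ℓ + m) * N + t))‖ ≤ c / 4 * (1 / 2) ^ K := by
    rw [Filter.eventually_all_finset]
    exact fun K _ => hL K
  obtain ⟨j, hj1, hj2⟩ := (hfr.and_eventually h3).exists
  by_contra hno
  push Not at hno
  have hBd : ∀ K, Bd (fun N => ind (BadS A ℓ m t K (L K)) N * q j ((ℓ + m) * N + t)) := fun K =>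
    (box_ind _).bd.mul ((hqb j).bd.comp _)
  have h4 := hS.mono (f := fun N => q j ((ℓ + m) * N + t))
    (g := ∑ K ∈ Finset.range (n + 1), fun N => ind (BadS A ℓ m t K (L K)) N * q j ((ℓ + m) * N + t))
    ((hqb j).bd.comp _) (Bd.sum _ _ fun K _ => hBd K) (fun N => by
      obtain ⟨K, hK, hKN⟩ := hno N
      rw [Finset.sum_apply]
      have := Finset.single_le_sum (f := fun K => ind (BadS A ℓ m t K (L K)) N * q j ((ℓ + m) * N + t))
        (fun i _ => mul_nonneg (box_ind _ N).1 (hqb j _).1) (Finset.mem_range.2 (Nat.lt_succ_of_le hK))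
      refine le_trans ?_ this
      beta_reduce
      rw [ind_mem hKN, one_mul])
  rw [map_sum] at h4
  have h5 := (Complex.le_def.1 h4).1
  have h6 := (Complex.re_le_norm _).trans ((norm_sum_le _ _).trans (Finset.sum_le_sum hj2))
  rw [← Finset.mul_sum] at h6
  have h7 := sum_geometric_two_le (n + 1)
  nlinarith

theorem mB_add_lB_shifted (ℓ m : ℕ) (hℓ : 0 < ℓ) (hm : 0 < m)
    (A : Set ℕ) (hA : 0 < upperBanachDensity A) :
    ∃ B : Set ℕ, B.Infinite ∧ ∃ t : ℕ, 0 < t ∧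
      ∀ b₁ ∈ B, ∀ b₂ ∈ B, b₁ < b₂ → m * b₁ + ℓ * b₂ + t ∈ A := by
  obtain ⟨t, ht, L, hL⟩ := exists_good ℓ m hℓ hm A hA
  choose N hN using hL
  let F : Ultrafilter ℕ := hyperfilter ℕ
  let x : ℕ → Prop := fun i => ∀ᶠ n in (F : Filter ℕ), ℓ * N n + i ∈ A
  have hstep : ∀ K, ∃ b, K ≤ b ∧ (∀ j ≤ K, x j → ℓ * b + j ∈ A) ∧ x (m * b + t) := by
    intro K
    have hge : ∀ᶠ n in (F : Filter ℕ), K ≤ n := by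
      have : (F : Filter ℕ) ≤ atTop := by
        rw [← Nat.cofinite_eq_atTop]; exact hyperfilter_le_cofinite
      exact this (eventually_ge_atTop K)
    have h1 : ∀ᶠ n in (F : Filter ℕ), ∃ b ∈ Set.Icc K (L K),
        (∀ j ≤ K, (ℓ * b + j ∈ A ↔ ℓ * N n + j ∈ A)) ∧ ℓ * N n + m * b + t ∈ A := by
      filter_upwards [hge] with n hn
      have := hN n K hn
      simp only [BadS, Set.mem_setOf_eq] at this
      push Not at this
      obtain ⟨b, hb1, hb2, hb3, hb4⟩ := this
      exact ⟨b, ⟨hb1, hb2⟩, hb3, hb4⟩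
    obtain ⟨b, hb, h2⟩ := (Ultrafilter.eventually_exists_mem_iff (Set.finite_Icc K (L K))).1 h1
    refine ⟨b, hb.1, fun j hj hx => ?_, ?_⟩
    · obtain ⟨n, h3, h4⟩ := (h2.and hx).exists
      exact (h3.1 j hj).2 h4
    · exact h2.mono fun n hn => by rw [← add_assoc]; exact hn.2
  choose f hf1 hf2 hf3 using hstep
  let b : ℕ → ℕ := fun n => Nat.rec (f 0) (fun _ y => f (m * y + t + y + 1)) n
  have hbs : ∀ n, b (n + 1) = f (m * b n + t + b n + 1) := fun n => rfl
  have hmono : StrictMono b := strictMono_nat_of_lt_succ fun n => by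
    have := hf1 (m * b n + t + b n + 1)
    rw [hbs]; omega
  have hx : ∀ n, x (m * b n + t) := fun n => by
    cases n with
    | zero => exact hf3 0
    | succ n => rw [hbs]; exact hf3 _
  refine ⟨Set.range b, Set.infinite_range_of_injective hmono.injective, t, ht, ?_⟩
  rintro _ ⟨i, rfl⟩ _ ⟨k, rfl⟩ hik
  have hlt : i < k := hmono.lt_iff_lt.1 hik
  obtain ⟨k, rfl⟩ : ∃ k', k = k' + 1 := ⟨k - 1, by omega⟩
  have hle : b i ≤ b k := hmono.monotone (by omega)
  have h5 := hf2 (m * b k + t + b k + 1) (m * b i + t) (by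
    have := Nat.mul_le_mul_left m hle
    omega) (hx i)
  rw [← hbs] at h5
  have e : m * b i + ℓ * b (k + 1) + t = ℓ * b (k + 1) + (m * b i + t) := by ring
  rw [e]
  exact h5
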